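/- arXiv:1401.2249 — 2 statements merged into one kernel-verified Lean document; each statement's English description precedes it below -/
import Mathlib

section
/- Let n ≥ 2 and let K be a compact polynomially convex subset of the open unit ball 𝔹_n = {z ∈ ℂ^n : |z| < 1}. Then there exists a compact subset X of the unit sphere ∂𝔹_n = {z ∈ ℂ^n : |z| = 1} such that K ⊆ X̂ and the set X̂ \ K contains no analytic disk. -/
open Metric

noncomputable def polyHull {m : ℕ} (K : Set (Fin m → ℂ)) : Set (Fin m → ℂ) :=
  {z | ∀ p : MvPolynomial (Fin m) ℂ,
    ‖MvPolynomial.eval z p‖ ≤ sSup ((fun w => ‖MvPolynomial.eval w p‖) '' K)}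

def NoAnalyticDisk {m : ℕ} (S : Set (Fin m → ℂ)) : Prop :=
  ∀ φ : ℂ → (Fin m → ℂ), DifferentiableOn ℂ φ (ball (0:ℂ) 1) →
    (∀ z ∈ ball (0:ℂ) 1, φ z ∈ S) →
    ∀ z ∈ ball (0:ℂ) 1, ∀ w ∈ ball (0:ℂ) 1, φ z = φ w

/-- The open unit (Euclidean) ball `𝔹_n ⊆ ℂⁿ`. -/
def euclBall (n : ℕ) : Set (Fin n → ℂ) := {z | ∑ i, ‖z i‖ ^ 2 < 1}

/-- The unit (Euclidean) sphere `∂𝔹_n ⊆ ℂⁿ`. -/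
def euclSphere (n : ℕ) : Set (Fin n → ℂ) := {z | ∑ i, ‖z i‖ ^ 2 = 1}

open MvPolynomial

lemma quad_taylor {n : ℕ} (z : Fin n → ℂ) (i0 i1 : Fin n) (_h01 : i0 ≠ i1)
    (p : MvPolynomial (Fin n) ℂ) :
    ∃ a0 a1 b0 b1 b2 : ℂ, ∀ v0 v1 w0 w1 : ℂ, ∃ R : Polynomial ℂ, ∀ t : ℂ,
      eval (z + Pi.single i0 (t * v0 + t ^ 2 * w0) + Pi.single i1 (t * v1 + t ^ 2 * w1)) p
        = eval z p + t * (a0 * v0 + a1 * v1)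
          + t ^ 2 * (a0 * w0 + a1 * w1 + b0 * v0 ^ 2 + b1 * v0 * v1 + b2 * v1 ^ 2)
          + t ^ 3 * R.eval t := by
  induction p using MvPolynomial.induction_on with
  | C a =>
    refine ⟨0, 0, 0, 0, 0, fun v0 v1 w0 w1 => ⟨0, fun t => ?_⟩⟩
    simp
  | add p q hp hq =>
    obtain ⟨a0, a1, b0, b1, b2, H⟩ := hp
    obtain ⟨a0', a1', b0', b1', b2', H'⟩ := hq
    refine ⟨a0 + a0', a1 + a1', b0 + b0', b1 + b1', b2 + b2', fun v0 v1 w0 w1 => ?_⟩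
    obtain ⟨R, hR⟩ := H v0 v1 w0 w1
    obtain ⟨R', hR'⟩ := H' v0 v1 w0 w1
    refine ⟨R + R', fun t => ?_⟩
    rw [map_add, hR, hR', map_add, Polynomial.eval_add]
    ring
  | mul_X p i hp =>
    obtain ⟨a0, a1, b0, b1, b2, H⟩ := hp
    obtain ⟨s0, s1, hs⟩ : ∃ s0 s1 : ℂ, ∀ x y : ℂ,
        (z + Pi.single i0 x + Pi.single i1 y : Fin n → ℂ) i = z i + s0 * x + s1 * y := by
      refine ⟨if i = i0 then 1 else 0, if i = i1 then 1 else 0, fun x y => ?_⟩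
      simp [Pi.single_apply]
    refine ⟨a0 * z i + eval z p * s0, a1 * z i + eval z p * s1, b0 * z i + a0 * s0,
      b1 * z i + a0 * s1 + a1 * s0, b2 * z i + a1 * s1, fun v0 v1 w0 w1 => ?_⟩
    obtain ⟨R, hR⟩ := H v0 v1 w0 w1
    refine ⟨R * (Polynomial.C (z i) + Polynomial.X * Polynomial.C (s0 * v0 + s1 * v1)
        + Polynomial.X ^ 2 * Polynomial.C (s0 * w0 + s1 * w1))
      + Polynomial.C ((a0 * v0 + a1 * v1) * (s0 * w0 + s1 * w1))
      + Polynomial.C (a0 * w0 + a1 * w1 + b0 * v0 ^ 2 + b1 * v0 * v1 + b2 * v1 ^ 2)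
        * (Polynomial.C (s0 * v0 + s1 * v1) + Polynomial.X * Polynomial.C (s0 * w0 + s1 * w1)),
      fun t => ?_⟩
    rw [map_mul, hR, map_mul, eval_X, hs, eval_X]
    simp only [Polynomial.eval_add, Polynomial.eval_mul, Polynomial.eval_C, Polynomial.eval_X,
      Polynomial.eval_pow]
    ring

lemma quad_dir (a0 a1 b0 b1 b2 : ℂ) : ∃ v0 v1 w0 w1 : ℂ, (v0 ≠ 0 ∨ v1 ≠ 0) ∧
    a0 * v0 + a1 * v1 = 0 ∧
    a0 * w0 + a1 * w1 + b0 * v0 ^ 2 + b1 * v0 * v1 + b2 * v1 ^ 2 = 0 := by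
  by_cases h0 : a0 = 0
  · by_cases h1 : a1 = 0
    · subst h0 h1
      by_cases h2 : b2 = 0
      · exact ⟨0, 1, 0, 0, by simp, by simp, by simp [h2]⟩
      · obtain ⟨s, hs⟩ := IsAlgClosed.exists_pow_nat_eq (discrim b2 b1 b0) (n := 2) (by norm_num)
        obtain ⟨x, hx⟩ := exists_quadratic_eq_zero h2 ⟨s, by rw [← hs]; ring⟩
        exact ⟨1, x, 0, 0, by simp, by simp, by linear_combination hx⟩
    · refine ⟨1, 0, 0, -b0 / a1, by simp, by simp [h0], ?_⟩
      field_simp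
      simp [h0]
  · refine ⟨-a1, a0, -(b0 * a1 ^ 2 - b1 * a1 * a0 + b2 * a0 ^ 2) / a0, 0, by simp [h0], by ring, ?_⟩
    field_simp
    ring

lemma no_local_max_re {E : Type*} [NormedAddCommGroup E] [NormedSpace ℂ E] {g : E → ℂ} {z : E}
    (hg : AnalyticAt ℂ g z) (h : ∀ᶠ y in nhds z, (g y).re ≤ (g z).re) :
    ∀ᶠ y in nhds z, g y = g z := by
  rcases hg.eventually_constant_or_nhds_le_map_nhds with h1 | h1
  · exact h1
  · exfalso
    have h2 : ∀ᶠ w in Filter.map g (nhds z), w.re ≤ (g z).re := h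
    have h3 : ∀ᶠ w in nhds (g z), w.re ≤ (g z).re := h1 h2
    obtain ⟨r, hr, hb⟩ := Metric.eventually_nhds_iff.1 h3
    have := @hb (g z + ((r / 2 : ℝ) : ℂ)) (by
      rw [dist_eq_norm, add_sub_cancel_left, Complex.norm_real, Real.norm_of_nonneg (by positivity)]
      linarith)
    simp only [Complex.add_re, Complex.ofReal_re] at this
    linarith

lemma norm_sq_expand (a b : ℂ) :
    ‖a‖ ^ 2 = ‖b‖ ^ 2 + (2 * (starRingEnd ℂ) b * (a - b)).re + ‖a - b‖ ^ 2 := by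
  rw [← Complex.normSq_eq_norm_sq, ← Complex.normSq_eq_norm_sq, ← Complex.normSq_eq_norm_sq]
  simp [Complex.normSq_apply]
  ring

lemma continuous_sqn {n : ℕ} : Continuous (fun z : Fin n → ℂ => ∑ i, ‖z i‖ ^ 2) := by
  fun_prop

lemma coord_le {n : ℕ} {z : Fin n → ℂ} (h : ∑ i, ‖z i‖ ^ 2 ≤ 1) (i : Fin n) : ‖z i‖ ≤ 1 := by
  have h1 : ‖z i‖ ^ 2 ≤ ∑ i, ‖z i‖ ^ 2 :=
    Finset.single_le_sum (f := fun i => ‖z i‖ ^ 2) (fun j _ => by positivity) (Finset.mem_univ i)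
  nlinarith [norm_nonneg (z i)]

lemma compact_sqball {n : ℕ} : IsCompact {z : Fin n → ℂ | ∑ i, ‖z i‖ ^ 2 ≤ 1} := by
  refine Metric.isCompact_of_isClosed_isBounded (isClosed_le continuous_sqn continuous_const) ?_
  refine (Metric.isBounded_closedBall (x := (0 : Fin n → ℂ)) (r := 1)).subset fun z hz => ?_
  rw [mem_closedBall_zero_iff, pi_norm_le_iff_of_nonneg zero_le_one]
  exact fun i => coord_le hz i

lemma compact_sqsphere {n : ℕ} : IsCompact {z : Fin n → ℂ | ∑ i, ‖z i‖ ^ 2 = 1} :=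
  compact_sqball.of_isClosed_subset (isClosed_eq continuous_sqn continuous_const)
    fun _ hz => le_of_eq hz

lemma maxp_aux {n : ℕ} (hn : 2 ≤ n) (f p : MvPolynomial (Fin n) ℂ)
    (hnc : ∃ a b, eval a f ≠ eval b f) (z0 : Fin n → ℂ)
    (hz0 : ∑ i, ‖z0 i‖ ^ 2 < 1) (hf : 0 < (eval z0 f).re) :
    ∃ z : Fin n → ℂ, ∑ i, ‖z i‖ ^ 2 = 1 ∧ 0 ≤ (eval z f).re ∧ ‖eval z0 p‖ ≤ ‖eval z p‖ := by
  by_contra! hcon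
  have cf := MvPolynomial.continuous_eval f
  have cp := MvPolynomial.continuous_eval p
  have cfr : Continuous fun z => (eval z f).re := Complex.continuous_re.comp cf
  -- gap
  obtain ⟨ε, hε, hgap⟩ : ∃ ε > 0, ∀ z : Fin n → ℂ, ∑ i, ‖z i‖ ^ 2 = 1 → 0 ≤ (eval z f).re →
      ‖eval z p‖ ^ 2 + ε < ‖eval z0 p‖ ^ 2 := by
    have hXc : IsCompact ({z : Fin n → ℂ | ∑ i, ‖z i‖ ^ 2 = 1} ∩ {z | 0 ≤ (eval z f).re}) :=
      compact_sqsphere.inter_right (isClosed_le continuous_const cfr)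
    rcases Set.eq_empty_or_nonempty
      ({z : Fin n → ℂ | ∑ i, ‖z i‖ ^ 2 = 1} ∩ {z | 0 ≤ (eval z f).re}) with he | hne
    · refine ⟨1, one_pos, fun z h1 h2 => ?_⟩
      have : z ∈ ({z : Fin n → ℂ | ∑ i, ‖z i‖ ^ 2 = 1} ∩ {z | 0 ≤ (eval z f).re}) := ⟨h1, h2⟩
      rw [he] at this
      exact this.elim
    · obtain ⟨y, hy, hmax⟩ := hXc.exists_isMaxOn hne (cp.norm.continuousOn)
      have h1 := hcon y hy.1 hy.2
      refine ⟨(‖eval z0 p‖ ^ 2 - ‖eval y p‖ ^ 2) / 2, ?_, fun z hz1 hz2 => ?_⟩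
      · nlinarith [norm_nonneg (eval y p)]
      · have h2 : ‖eval z p‖ ≤ ‖eval y p‖ := hmax ⟨hz1, hz2⟩
        nlinarith [norm_nonneg (eval y p), norm_nonneg (eval z p)]
  set u : (Fin n → ℂ) → ℝ := fun z => ‖eval z p‖ ^ 2 + ε * ∑ i, ‖z i‖ ^ 2 with hu
  have cu : Continuous u := (cp.norm.pow 2).add (continuous_const.mul continuous_sqn)
  have hTc : IsCompact ({z : Fin n → ℂ | ∑ i, ‖z i‖ ^ 2 ≤ 1} ∩
      ({z | 0 ≤ (eval z f).re} ∩ {z | u z0 ≤ u z})) :=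
    compact_sqball.inter_right ((isClosed_le continuous_const cfr).inter
      (isClosed_le continuous_const cu))
  obtain ⟨z1, ⟨hz1a, hz1b, hz1c⟩, hmax⟩ := hTc.exists_isMaxOn
    ⟨z0, hz0.le, hf.le, le_refl (u z0)⟩ cfr.continuousOn
  have hz1s : ∑ i, ‖z1 i‖ ^ 2 < 1 := by
    rcases lt_or_eq_of_le (show ∑ i, ‖z1 i‖ ^ 2 ≤ 1 from hz1a) with h | h
    · exact h
    · exfalso
      have h1 := hgap z1 h hz1b
      have h2 : u z0 ≤ u z1 := hz1c
      simp only [hu, h] at h2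
      have : 0 ≤ ε * ∑ i, ‖z0 i‖ ^ 2 := by positivity
      linarith
  have key : ∀ z : Fin n → ℂ, ∑ i, ‖z i‖ ^ 2 < 1 → u z1 < u z → (eval z f).re ≤ (eval z1 f).re := by
    intro z h1 h2
    by_contra! h3
    have hb : 0 ≤ (eval z1 f).re := hz1b
    have hc : u z0 ≤ u z1 := hz1c
    have : (eval z f).re ≤ (eval z1 f).re :=
      hmax ⟨h1.le, by simp only [Set.mem_ofPred_eq]; linarith, hc.trans h2.le⟩
    linarith
  set G : MvPolynomial (Fin n) ℂ := C (2 * (starRingEnd ℂ) (eval z1 p)) * p +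
    ∑ i, C (2 * ε * (starRingEnd ℂ) (z1 i)) * X i with hG
  have hexp : ∀ z : Fin n → ℂ, u z = u z1 + (eval z G - eval z1 G).re + ‖eval z p - eval z1 p‖ ^ 2
      + ε * ∑ i, ‖z i - z1 i‖ ^ 2 := by
    intro z
    have e1 : eval z G - eval z1 G = 2 * (starRingEnd ℂ) (eval z1 p) * (eval z p - eval z1 p)
        + ∑ i, (ε : ℂ) * (2 * (starRingEnd ℂ) (z1 i) * (z i - z1 i)) := by
      simp only [hG, map_add, map_mul, map_sum, eval_C, eval_X]
      rw [mul_sub, add_sub_add_comm, ← Finset.sum_sub_distrib]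
      congr 1
      refine Finset.sum_congr rfl fun i _ => by ring
    rw [e1, Complex.add_re, Complex.re_sum]
    simp only [Complex.re_ofReal_mul, hu]
    rw [← Finset.mul_sum, norm_sq_expand (eval z p) (eval z1 p),
      Finset.sum_congr rfl fun i _ => norm_sq_expand (z i) (z1 i)]
    simp only [Finset.sum_add_distrib]
    ring
  -- disc
  obtain ⟨i0, i1, h01⟩ : ∃ i0 i1 : Fin n, i0 ≠ i1 :=
    ⟨⟨0, by omega⟩, ⟨1, by omega⟩, by simp⟩
  obtain ⟨a0, a1, b0, b1, b2, H⟩ := quad_taylor z1 i0 i1 h01 G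
  obtain ⟨v0, v1, w0, w1, hv, hlin, hquad⟩ := quad_dir a0 a1 b0 b1 b2
  obtain ⟨R, hR⟩ := H v0 v1 w0 w1
  simp only [hlin, hquad, mul_zero, add_zero] at hR
  set ψ : ℂ → (Fin n → ℂ) := fun t =>
    z1 + Pi.single i0 (t * v0 + t ^ 2 * w0) + Pi.single i1 (t * v1 + t ^ 2 * w1) with hψ
  have dsing : ∀ i : Fin n, Differentiable ℂ (fun x : ℂ => (Pi.single i x : Fin n → ℂ)) := by
    intro i
    exact (ContinuousLinearMap.single ℂ (fun _ : Fin n => ℂ) i).differentiable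
  have dψ : Differentiable ℂ ψ := by
    refine ((differentiable_const _).add ((dsing i0).comp ?_)).add ((dsing i1).comp ?_) <;> fun_prop
  have cψ : Continuous ψ := dψ.continuous
  have hψ0 : ψ 0 = z1 := by simp [hψ]
  have hsq : ∀ t, ‖t * v0 + t ^ 2 * w0‖ ^ 2 + ‖t * v1 + t ^ 2 * w1‖ ^ 2
      ≤ ∑ i, ‖ψ t i - z1 i‖ ^ 2 := by
    intro t
    have h1 : ψ t i0 - z1 i0 = t * v0 + t ^ 2 * w0 := by simp [hψ, h01]
    have h2 : ψ t i1 - z1 i1 = t * v1 + t ^ 2 * w1 := by simp [hψ, h01.symm]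
    rw [← h1, ← h2, ← Finset.sum_pair h01 (f := fun i => ‖ψ t i - z1 i‖ ^ 2)]
    exact Finset.sum_le_sum_of_subset_of_nonneg (Finset.subset_univ _) fun i _ _ => by positivity
  have hev : ∀ᶠ t in nhds (0 : ℂ), 0 < ε * (‖v0 + t * w0‖ ^ 2 + ‖v1 + t * w1‖ ^ 2)
      - ‖t‖ * ‖R.eval t‖ := by
    have c1 : Continuous fun t : ℂ => ε * (‖v0 + t * w0‖ ^ 2 + ‖v1 + t * w1‖ ^ 2)
      - ‖t‖ * ‖R.eval t‖ := by
      have := R.continuous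
      fun_prop
    refine c1.continuousAt.eventually (lt_mem_nhds ?_)
    simp only [zero_mul, add_zero, norm_zero, sub_zero]
    have : 0 < ‖v0‖ ^ 2 + ‖v1‖ ^ 2 := by
      rcases hv with h | h
      · have := norm_pos_iff.2 h
        positivity
      · have := norm_pos_iff.2 h
        positivity
    positivity
  have hup : ∀ᶠ t in nhds (0 : ℂ), t ≠ 0 → u z1 < u (ψ t) := by
    filter_upwards [hev] with t ht ht0
    rw [hexp (ψ t)]
    have e1 : eval (ψ t) G - eval z1 G = t ^ 3 * R.eval t := by
      rw [hψ]; simp only [hR]; ring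
    rw [e1]
    have h1 : -(‖t‖ ^ 3 * ‖R.eval t‖) ≤ (t ^ 3 * R.eval t).re := by
      have := Complex.abs_re_le_norm (t ^ 3 * R.eval t)
      rw [norm_mul, norm_pow] at this
      exact (abs_le.1 this).1
    have h2 := hsq t
    have e2 : ‖t * v0 + t ^ 2 * w0‖ ^ 2 + ‖t * v1 + t ^ 2 * w1‖ ^ 2
        = ‖t‖ ^ 2 * (‖v0 + t * w0‖ ^ 2 + ‖v1 + t * w1‖ ^ 2) := by
      rw [show t * v0 + t ^ 2 * w0 = t * (v0 + t * w0) by ring,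
        show t * v1 + t ^ 2 * w1 = t * (v1 + t * w1) by ring, norm_mul, norm_mul]
      ring
    rw [e2] at h2
    have h3 : 0 < ‖t‖ ^ 2 * (ε * (‖v0 + t * w0‖ ^ 2 + ‖v1 + t * w1‖ ^ 2)
      - ‖t‖ * ‖R.eval t‖) := mul_pos (by have := norm_pos_iff.2 ht0; positivity) ht
    have h4 := mul_le_mul_of_nonneg_left h2 hε.le
    have h5 : 0 ≤ ‖eval (ψ t) p - eval z1 p‖ ^ 2 := by positivity
    nlinarith
  have hin : ∀ᶠ t in nhds (0 : ℂ), ∑ i, ‖ψ t i‖ ^ 2 < 1 := by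
    refine (continuous_sqn.comp cψ).continuousAt.eventually (gt_mem_nhds ?_)
    simpa [hψ0] using hz1s
  have han : AnalyticOnNhd ℂ (fun z => eval z f) Set.univ := AnalyticOnNhd.eval_mvPolynomial f
  have hanψ : AnalyticAt ℂ (fun t => eval (ψ t) f) 0 := by
    have h2 : AnalyticAt ℂ ψ 0 := dψ.analyticAt 0
    exact AnalyticAt.comp (g := fun z => eval z f) (han _ trivial) h2
  have hconst := no_local_max_re hanψ (by
    filter_upwards [hup, hin] with t h1 h2
    by_cases h0 : t = 0
    · rw [h0]
    · rw [hψ0]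
      exact key _ h2 (h1 h0))
  obtain ⟨t, ht0, htu, htin, htc⟩ : ∃ t : ℂ, t ≠ 0 ∧ u z1 < u (ψ t) ∧ ∑ i, ‖ψ t i‖ ^ 2 < 1 ∧
      eval (ψ t) f = eval z1 f := by
    have h := (hup.and (hin.and hconst))
    have h' := (h.filter_mono nhdsWithin_le_nhds).and
      (self_mem_nhdsWithin : {(0:ℂ)}ᶜ ∈ nhdsWithin (0:ℂ) {0}ᶜ)
    obtain ⟨t, ⟨h1, h2, h3⟩, h4⟩ := h'.exists
    exact ⟨t, h4, h1 h4, h2, by simpa [hψ0] using h3⟩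
  have hloc := no_local_max_re (han (ψ t) trivial) (by
    have e1 := cu.continuousAt.eventually (lt_mem_nhds htu)
    have e2 := (continuous_sqn (n := n)).continuousAt.eventually (gt_mem_nhds htin)
    filter_upwards [e1, e2] with z h1 h2
    rw [htc]
    exact key z h2 h1)
  have hall := han.eqOn_of_preconnected_of_eventuallyEq (analyticOnNhd_const (v := eval (ψ t) f))
    isPreconnected_univ (Set.mem_univ (ψ t)) hloc
  obtain ⟨a, b, hab⟩ := hnc
  exact hab ((hall (Set.mem_univ a)).trans (hall (Set.mem_univ b)).symm)

lemma maxp {n : ℕ} (hn : 2 ≤ n) (f p : MvPolynomial (Fin n) ℂ) (z0 : Fin n → ℂ)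
    (hz0 : ∑ i, ‖z0 i‖ ^ 2 < 1) (hf : 0 < (eval z0 f).re) :
    ∃ z : Fin n → ℂ, ∑ i, ‖z i‖ ^ 2 = 1 ∧ 0 ≤ (eval z f).re ∧ ‖eval z0 p‖ ≤ ‖eval z p‖ := by
  by_cases hnc : ∃ a b, eval a f ≠ eval b f
  · exact maxp_aux hn f p hnc z0 hz0 hf
  · push Not at hnc
    have i0 : Fin n := ⟨0, by omega⟩
    obtain ⟨z, h1, -, h3⟩ := maxp_aux hn (C 2 + X i0) p
      ⟨0, Pi.single i0 1, by simp⟩ z0 hz0 (by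
        have h1 := coord_le hz0.le i0
        have h2 := (abs_le.1 (Complex.abs_re_le_norm (z0 i0))).1
        simp only [map_add, eval_C, eval_X, Complex.add_re, Complex.re_ofNat]
        linarith)
    exact ⟨z, h1, by rw [hnc z z0]; exact hf.le, h3⟩

lemma step_identity_ne (z : ℂ) (hz : z.re ≠ 0) (m : ℕ) (hm : m ≠ 0) :
    (1 + z) ^ m + (1 - z) ^ m ≠ 0 := by
  intro h
  have h1 : (1 + z) ^ m = -(1 - z) ^ m := by linear_combination h
  have h2 : ‖1 + z‖ ^ m = ‖1 - z‖ ^ m := by rw [← norm_pow, ← norm_pow, h1, norm_neg]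
  have h3 : ‖1 + z‖ = ‖1 - z‖ := (pow_left_inj₀ (norm_nonneg _) (norm_nonneg _) hm).1 h2
  have h4 : ‖1 + z‖ ^ 2 = ‖1 - z‖ ^ 2 := by rw [h3]
  rw [← Complex.normSq_eq_norm_sq, ← Complex.normSq_eq_norm_sq] at h4
  simp [Complex.normSq_apply] at h4
  exact hz (by linarith)

lemma ratio_bound (δ R : ℝ) (hδ : 0 < δ) : ∃ ρ : ℝ, 0 ≤ ρ ∧ ρ < 1 ∧ ∀ z : ℂ, ‖z‖ ≤ R → δ ≤ z.re →
    ‖1 - z‖ ≤ ρ * ‖1 + z‖ := by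
  have hc : IsCompact (Metric.closedBall (0 : ℂ) R ∩ {z : ℂ | δ ≤ z.re}) :=
    (isCompact_closedBall _ _).inter_right (isClosed_le continuous_const Complex.continuous_re)
  have hpos : ∀ z : ℂ, δ ≤ z.re → 0 < ‖1 + z‖ := by
    intro z hz
    have := Complex.re_le_norm (1 + z)
    simp at this
    linarith
  rcases Set.eq_empty_or_nonempty (Metric.closedBall (0 : ℂ) R ∩ {z : ℂ | δ ≤ z.re}) with he | hne
  · refine ⟨0, le_rfl, one_pos, fun z h1 h2 => ?_⟩
    have : z ∈ Metric.closedBall (0 : ℂ) R ∩ {z : ℂ | δ ≤ z.re} := ⟨by simpa using h1, h2⟩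
    rw [he] at this
    exact this.elim
  · obtain ⟨y, hy, hmax⟩ := hc.exists_isMaxOn hne (f := fun z : ℂ => ‖1 - z‖ / ‖1 + z‖) (by
      refine ContinuousOn.div (by fun_prop) (by fun_prop) fun z hz => (hpos z hz.2).ne')
    refine ⟨‖1 - y‖ / ‖1 + y‖, by positivity, ?_, fun z h1 h2 => ?_⟩
    · rw [div_lt_one (hpos y hy.2)]
      have h4 : ‖1 - y‖ ^ 2 < ‖1 + y‖ ^ 2 := by
        rw [← Complex.normSq_eq_norm_sq, ← Complex.normSq_eq_norm_sq]
        have : δ ≤ y.re := hy.2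
        simp [Complex.normSq_apply]
        nlinarith
      exact lt_of_pow_lt_pow_left₀ 2 (norm_nonneg _) h4
    · have := hmax (show z ∈ _ from ⟨by simpa using h1, h2⟩)
      simp only [Set.mem_ofPred_eq] at this
      rwa [div_le_iff₀ (hpos z h2)] at this

lemma planar_step (δ R ε : ℝ) (hδ : 0 < δ) (hε : 0 < ε) : ∃ h : Polynomial ℂ,
    (∀ w : ℂ, ‖w‖ ≤ R → w.re ≤ 0 → ‖h.eval w‖ ≤ ε) ∧
    (∀ w : ℂ, ‖w‖ ≤ R → δ ≤ w.re → ‖h.eval w - 1‖ ≤ ε) := by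
  obtain ⟨ρ, hρ0, hρ1, hρ⟩ := ratio_bound (δ / 2) (R + δ) (by linarith)
  obtain ⟨m, hm0, hm1, hm2⟩ : ∃ m : ℕ, m ≠ 0 ∧ ρ ^ m ≤ 1 / 2 ∧ ρ ^ m ≤ ε / 4 := by
    have h1 := (tendsto_pow_atTop_nhds_zero_of_lt_one hρ0 hρ1)
    have h2 := h1.eventually (gt_mem_nhds (show (0:ℝ) < 1 / 2 by norm_num))
    have h3 := h1.eventually (gt_mem_nhds (show (0:ℝ) < ε / 4 by linarith))
    obtain ⟨m, ⟨h4, h5⟩, h6⟩ := ((h2.and h3).and (Filter.eventually_ne_atTop 0)).exists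
    exact ⟨m, h6, h4.le, h5.le⟩
  -- elementary estimate
  have hest : ∀ z : ℂ, ‖z‖ ≤ R + δ → δ / 2 ≤ z.re →
      ‖(1 - z) ^ m / ((1 + z) ^ m + (1 - z) ^ m)‖ ≤ ε / 2 := by
    intro z h1 h2
    have h3 : ‖1 - z‖ ^ m ≤ ρ ^ m * ‖1 + z‖ ^ m := by
      rw [← mul_pow]
      exact pow_le_pow_left₀ (norm_nonneg _) (hρ z h1 h2) m
    have hp : 0 < ‖1 + z‖ := by
      have := Complex.re_le_norm (1 + z)
      simp at this
      linarith
    have hp' : 0 < ‖1 + z‖ ^ m := by positivity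
    have h4 : ‖1 + z‖ ^ m / 2 ≤ ‖(1 + z) ^ m + (1 - z) ^ m‖ := by
      have := norm_sub_le_norm_add ((1 + z) ^ m) ((1 - z) ^ m)
      rw [norm_pow, norm_pow] at this
      nlinarith
    rw [norm_div, norm_pow, div_le_iff₀ (by linarith)]
    nlinarith
  set E : Set ℂ := Metric.closedBall (0 : ℂ) R ∩ {w : ℂ | w.re ≤ 0 ∨ δ ≤ w.re} with hE
  by_cases hR : R < 0
  · exact ⟨0, fun w h => absurd (norm_nonneg w) (by linarith),
      fun w h => absurd (norm_nonneg w) (by linarith)⟩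
  push Not at hR
  have hEc : IsCompact E := (isCompact_closedBall _ _).inter_right
    ((isClosed_le Complex.continuous_re continuous_const).union
      (isClosed_le continuous_const Complex.continuous_re))
  have : CompactSpace E := isCompact_iff_compactSpace.1 hEc
  have : Nonempty E := ⟨⟨0, by simp [hE, hR]⟩⟩
  set S : Subalgebra ℂ C(E, ℂ) := (polynomialFunctions E).topologicalClosure with hS
  have hScl : IsClosed (S : Set C(E, ℂ)) := (polynomialFunctions E).isClosed_topologicalClosure
  have : CompleteSpace S := hScl.completeSpace_coe
  let x : S := ⟨Polynomial.toContinuousMapOn Polynomial.X E,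
    (polynomialFunctions E).le_topologicalClosure ⟨Polynomial.X, trivial, rfl⟩⟩
  have hx : ∀ w : E, (x : C(E, ℂ)) w = w := by intro w; simp [x]
  have hspec : ∀ c : ℂ, c.re = δ / 2 → c ∉ spectrum ℂ x := by
    intro c hc hcs
    have hb := Subalgebra.spectrum_isBounded_connectedComponentIn S x hcs
    have hsub : {w : ℂ | w.re = δ / 2} ⊆ connectedComponentIn (spectrum ℂ (x : C(E, ℂ)))ᶜ c := by
      refine IsPreconnected.subset_connectedComponentIn ?_ hc ?_
      · have : Convex ℝ {w : ℂ | w.re = δ / 2} := convex_hyperplane Complex.reLm.isLinear (δ / 2)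
        exact this.isPreconnected
      · intro w hw hws
        rw [ContinuousMap.spectrum_eq_range] at hws
        obtain ⟨e, he⟩ := hws
        rw [hx] at he
        have h2 := e.2.2
        rw [he] at h2
        have hw' : w.re = δ / 2 := hw
        rcases h2 with h2 | h2 <;> simp only [hw'] at h2 <;> linarith
    obtain ⟨M, hM⟩ := (hb.subset hsub).exists_norm_le
    have := hM (⟨δ / 2, |M| + 1⟩ : ℂ) rfl
    have h2 := Complex.abs_im_le_norm (⟨δ / 2, |M| + 1⟩ : ℂ)
    simp only at h2
    have h3 := le_abs_self (|M| + 1)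
    have h4 := le_abs_self M
    linarith
  set Dp : Polynomial ℂ := (1 + (Polynomial.X - Polynomial.C ((δ / 2 : ℝ) : ℂ))) ^ m
    + (1 - (Polynomial.X - Polynomial.C ((δ / 2 : ℝ) : ℂ))) ^ m with hDp
  set Np : Polynomial ℂ := (1 + (Polynomial.X - Polynomial.C ((δ / 2 : ℝ) : ℂ))) ^ m with hNp
  have hunit : IsUnit (Polynomial.aeval x Dp) := by
    rw [← spectrum.zero_notMem_iff ℂ]
    rw [spectrum.map_polynomial_aeval_of_nonempty x Dp (spectrum.nonempty x)]
    rintro ⟨c, hc, hc0⟩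
    refine step_identity_ne (c - ((δ / 2 : ℝ) : ℂ)) ?_ m hm0 ?_
    · intro h
      refine hspec c ?_ hc
      simp only [Complex.sub_re, Complex.ofReal_re] at h
      linarith
    · simpa [hDp, hNp] using hc0
  obtain ⟨q, hq⟩ := hunit
  have hcoe : ∀ (P : Polynomial ℂ) (w : E), ((Polynomial.aeval x P : S) : C(E, ℂ)) w = P.eval (w : ℂ) := by
    intro P w
    have e1 : ((Polynomial.aeval x P : S) : C(E, ℂ)) = Polynomial.aeval (x : C(E, ℂ)) P :=
      (Polynomial.aeval_algHom_apply S.val x P).symm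
    rw [e1]
    have e2 := Polynomial.aeval_algHom_apply (ContinuousMap.evalAlgHom ℂ ℂ w) (x : C(E, ℂ)) P
    simp only [ContinuousMap.evalAlgHom_apply, hx] at e2
    rw [← e2, Polynomial.coe_aeval_eq_eval]
  have hinv : ∀ w : E, (((q⁻¹ : Sˣ) : S) : C(E, ℂ)) w * Dp.eval (w : ℂ) = 1 := by
    intro w
    have h1 : ((q⁻¹ : Sˣ) : S) * Polynomial.aeval x Dp = 1 := by rw [← hq]; simp
    have h2 := congrArg (fun s : S => (s : C(E, ℂ)) w) h1
    simpa [hcoe] using h2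
  set g : S := Polynomial.aeval x Np * ((q⁻¹ : Sˣ) : S) with hg
  have hgv : ∀ w : E, (g : C(E, ℂ)) w = Np.eval (w : ℂ) / Dp.eval (w : ℂ) := by
    intro w
    have h1 := hinv w
    have h2 : Dp.eval (w : ℂ) ≠ 0 := right_ne_zero_of_mul_eq_one h1
    rw [eq_div_iff h2]
    simp only [hg, Subalgebra.coe_mul, ContinuousMap.mul_apply, hcoe]
    rw [mul_assoc, h1, mul_one]
  have hgcl : (g : C(E, ℂ)) ∈ closure (polynomialFunctions E : Set C(E, ℂ)) := g.2
  obtain ⟨k, hk, hdist⟩ := Metric.mem_closure_iff.1 hgcl (ε / 2) (by linarith)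
  obtain ⟨h, -, rfl⟩ := hk
  have happ : ∀ w : E, ‖Np.eval (w : ℂ) / Dp.eval (w : ℂ) - h.eval (w : ℂ)‖ ≤ ε / 2 := by
    intro w
    have := (ContinuousMap.dist_apply_le_dist w).trans hdist.le
    rw [dist_eq_norm, hgv] at this
    simpa using this
  have hD0 : ∀ w : E, Dp.eval (w : ℂ) ≠ 0 := fun w => right_ne_zero_of_mul_eq_one (hinv w)
  have heN : ∀ w, Np.eval w = (1 + (w - ((δ / 2 : ℝ) : ℂ))) ^ m := by intro w; simp [hNp]
  have heD : ∀ w, Dp.eval w = (1 + (w - ((δ / 2 : ℝ) : ℂ))) ^ m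
      + (1 - (w - ((δ / 2 : ℝ) : ℂ))) ^ m := by intro w; simp [hDp, hNp]
  have hnz : ∀ w : ℂ, ‖w‖ ≤ R → ‖w - ((δ / 2 : ℝ) : ℂ)‖ ≤ R + δ := by
    intro w hw
    refine (norm_sub_le _ _).trans ?_
    rw [Complex.norm_real, Real.norm_of_nonneg (by linarith)]
    linarith
  refine ⟨h, fun w hw1 hw2 => ?_, fun w hw1 hw2 => ?_⟩
  · have h1 := happ ⟨w, by simpa using hw1, Or.inl hw2⟩
    simp only at h1
    have h2 := hest (-(w - ((δ / 2 : ℝ) : ℂ))) (by rw [norm_neg]; exact hnz w hw1)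
      (by simp only [Complex.neg_re, Complex.sub_re, Complex.ofReal_re]; linarith)
    rw [heN, heD] at h1
    rw [sub_neg_eq_add, ← sub_eq_add_neg, add_comm ((1 - _) ^ m)] at h2
    have h3 := norm_sub_norm_le (h.eval w) ((1 + (w - ((δ / 2 : ℝ) : ℂ))) ^ m /
      ((1 + (w - ((δ / 2 : ℝ) : ℂ))) ^ m + (1 - (w - ((δ / 2 : ℝ) : ℂ))) ^ m))
    rw [norm_sub_rev] at h3
    linarith
  · have h1 := happ ⟨w, by simpa using hw1, Or.inr hw2⟩
    have h0 := hD0 ⟨w, by simpa using hw1, Or.inr hw2⟩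
    simp only at h1 h0
    have h2 := hest (w - ((δ / 2 : ℝ) : ℂ)) (hnz w hw1)
      (by simp only [Complex.sub_re, Complex.ofReal_re]; linarith)
    rw [heN, heD] at h1
    rw [heD] at h0
    have e : h.eval w - 1 = -(((1 + (w - ((δ / 2 : ℝ) : ℂ))) ^ m /
      ((1 + (w - ((δ / 2 : ℝ) : ℂ))) ^ m + (1 - (w - ((δ / 2 : ℝ) : ℂ))) ^ m)) - h.eval w) -
      (1 - (w - ((δ / 2 : ℝ) : ℂ))) ^ m /
      ((1 + (w - ((δ / 2 : ℝ) : ℂ))) ^ m + (1 - (w - ((δ / 2 : ℝ) : ℂ))) ^ m) := by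
      field_simp
      ring
    rw [e]
    refine (norm_sub_le _ _).trans ?_
    rw [norm_neg]
    linarith

lemma hull_re_nonneg {n : ℕ} (X : Set (Fin n → ℂ)) (hX : IsCompact X)
    (f : MvPolynomial (Fin n) ℂ) (hf : ∀ z ∈ X, 0 ≤ (eval z f).re) (z : Fin n → ℂ)
    (hz : z ∈ polyHull X) : 0 ≤ (eval z f).re := by
  by_contra! hneg
  obtain ⟨M, hM⟩ := hX.exists_bound_of_continuousOn (MvPolynomial.continuous_eval f).continuousOn
  obtain ⟨T, hT0, hT⟩ : ∃ T : ℝ, 0 ≤ T ∧ M ^ 2 < T * (-(eval z f).re) := by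
    refine ⟨(M ^ 2 + 1) / (-(eval z f).re), ?_, ?_⟩
    · exact div_nonneg (by positivity) (by linarith)
    · rw [div_mul_cancel₀ _ (by linarith)]
      linarith
  have h := hz (f - C (T : ℂ))
  have hsq : ∀ w : ℂ, ‖w - T‖ ^ 2 = ‖w‖ ^ 2 - 2 * T * w.re + T ^ 2 := by
    intro w
    rw [← Complex.normSq_eq_norm_sq, ← Complex.normSq_eq_norm_sq]
    simp [Complex.normSq_apply]
    ring
  have hle : sSup ((fun w => ‖eval w (f - C (T : ℂ))‖) '' X) ≤ Real.sqrt (M ^ 2 + T ^ 2) := by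
    refine Real.sSup_le ?_ (Real.sqrt_nonneg _)
    rintro _ ⟨w, hw, rfl⟩
    refine Real.le_sqrt_of_sq_le ?_
    simp only [map_sub, eval_C]
    rw [hsq]
    have h1 := hM w hw
    have h2 := hf w hw
    have h3 : 0 ≤ T * (eval w f).re := mul_nonneg hT0 h2
    nlinarith [norm_nonneg (eval w f)]
  have h2 := h.trans hle
  rw [Real.le_sqrt (norm_nonneg _) (by positivity)] at h2
  simp only [map_sub, eval_C] at h2
  rw [hsq] at h2
  nlinarith [sq_nonneg ‖eval z f‖]

lemma step_poly {n : ℕ} (K : Set (Fin n → ℂ)) (hK : IsCompact K) (f r : MvPolynomial (Fin n) ℂ)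
    (hf : ∀ z ∈ K, 0 < (eval z f).re) (hr : ∀ z ∈ K, ‖eval z r‖ ≤ 1 / 2) :
    ∃ f' : MvPolynomial (Fin n) ℂ, (∀ z ∈ K, 0 < (eval z f').re) ∧
      (∀ z, ∑ i, ‖z i‖ ^ 2 = 1 → 0 ≤ (eval z f').re → 0 ≤ (eval z f).re) ∧
      (∀ z, eval z r = 1 → (eval z f').re < 0) := by
  have cf := MvPolynomial.continuous_eval f
  obtain ⟨R1, hR1⟩ := hK.exists_bound_of_continuousOn cf.continuousOn
  obtain ⟨R2, hR2⟩ := (compact_sqsphere (n := n)).exists_bound_of_continuousOn cf.continuousOn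
  obtain ⟨M, hM⟩ := (compact_sqsphere (n := n)).exists_bound_of_continuousOn
    (MvPolynomial.continuous_eval (1 - r)).continuousOn
  obtain ⟨δ, hδ, hδK⟩ : ∃ δ > 0, ∀ z ∈ K, δ ≤ (eval z f).re := by
    rcases K.eq_empty_or_nonempty with he | hne
    · exact ⟨1, one_pos, by simp [he]⟩
    · obtain ⟨y, hy, hmin⟩ := hK.exists_isMinOn hne (Complex.continuous_re.comp cf).continuousOn
      exact ⟨_, hf y hy, fun z hz => hmin hz⟩
  obtain ⟨ε, hε, hε1, hε2⟩ : ∃ ε > 0, ε ≤ (1 / 8 : ℝ) ∧ |M| * ε ≤ 1 / 8 := by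
    refine ⟨1 / (8 * (|M| + 1)), by positivity, ?_, ?_⟩
    · rw [div_le_div_iff₀ (by positivity) (by norm_num)]
      nlinarith [abs_nonneg M]
    · rw [mul_one_div, div_le_div_iff₀ (by positivity) (by norm_num)]
      nlinarith [abs_nonneg M]
  obtain ⟨h, hh1, hh2⟩ := planar_step δ (max R1 R2) ε hδ hε
  have hev : ∀ z, eval z ((1 - r) * Polynomial.aeval f h - C (1 / 4 : ℂ))
      = (1 - eval z r) * h.eval (eval z f) - 1 / 4 := by
    intro z
    have e2 := Polynomial.aeval_algHom_apply (MvPolynomial.aeval z : MvPolynomial (Fin n) ℂ →ₐ[ℂ] ℂ) f h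
    rw [Polynomial.coe_aeval_eq_eval] at e2
    simp only [MvPolynomial.aeval_eq_eval] at e2
    simp only [map_sub, map_mul, map_one, eval_C]
    congr 2
    exact e2.symm
  refine ⟨(1 - r) * Polynomial.aeval f h - C (1 / 4 : ℂ), fun z hz => ?_, fun z hz hre => ?_,
    fun z hz => ?_⟩
  · rw [hev]
    have h1 := hh2 (eval z f) ((hR1 z hz).trans (le_max_left _ _)) (hδK z hz)
    have h2 := hr z hz
    have e : (1 - eval z r) * h.eval (eval z f) - 1 / 4
        = ((3 / 4 : ℝ) : ℂ) + (-(eval z r) + (1 - eval z r) * (h.eval (eval z f) - 1)) := by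
      push_cast; ring
    rw [e, Complex.add_re, Complex.ofReal_re]
    have h3 : ‖-(eval z r) + (1 - eval z r) * (h.eval (eval z f) - 1)‖ ≤ 1 / 2 + 3 / 2 * (1 / 8) := by
      refine (norm_add_le _ _).trans (add_le_add (by rwa [norm_neg]) ?_)
      rw [norm_mul]
      refine mul_le_mul ?_ (h1.trans hε1) (norm_nonneg _) (by norm_num)
      refine (norm_sub_le _ _).trans ?_
      rw [norm_one]
      linarith
    have h4 := (abs_le.1 (Complex.abs_re_le_norm
      (-(eval z r) + (1 - eval z r) * (h.eval (eval z f) - 1)))).1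
    linarith
  · by_contra! hneg
    rw [hev] at hre
    have h1 := hh1 (eval z f) ((hR2 z hz).trans (le_max_right _ _)) hneg.le
    have h2 := hM z hz
    simp only [map_sub, map_one] at h2
    have h3 : ‖(1 - eval z r) * h.eval (eval z f)‖ ≤ 1 / 8 := by
      rw [norm_mul]
      exact (mul_le_mul (h2.trans (le_abs_self M)) h1 (norm_nonneg _) (abs_nonneg _)).trans hε2
    have h4 := Complex.re_le_norm ((1 - eval z r) * h.eval (eval z f))
    have h5 : ((1 / 4 : ℂ)).re = 1 / 4 := by norm_num
    rw [Complex.sub_re, h5] at hre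
    linarith
  · rw [hev, hz]
    norm_num

lemma dense_polys (n : ℕ) : ∃ s : ℕ → MvPolynomial (Fin n) ℂ, ∀ (q : MvPolynomial (Fin n) ℂ)
    (ε : ℝ), 0 < ε → ∃ k, ∀ z : Fin n → ℂ, (∀ i, ‖z i‖ ≤ 1) → ‖eval z q - eval z (s k)‖ < ε := by
  let Y : Set (Fin n → ℂ) := Metric.closedBall 0 1
  have : CompactSpace Y := isCompact_iff_compactSpace.1 (isCompact_closedBall _ _)
  let Φ : MvPolynomial (Fin n) ℂ → C(Y, ℂ) := fun q =>
    ⟨fun z => eval (z : Fin n → ℂ) q, (MvPolynomial.continuous_eval q).comp continuous_subtype_val⟩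
  have : Nonempty (Set.range Φ) := ⟨⟨_, 0, rfl⟩⟩
  have hd := TopologicalSpace.denseRange_denseSeq (Set.range Φ)
  choose s hs using fun k => (TopologicalSpace.denseSeq (Set.range Φ) k).2
  refine ⟨s, fun q ε hε => ?_⟩
  obtain ⟨k, hk⟩ := hd.exists_dist_lt (⟨Φ q, q, rfl⟩ : Set.range Φ) hε
  refine ⟨k, fun z hz => ?_⟩
  have hzY : z ∈ Y := by
    simp only [Y, mem_closedBall_zero_iff]
    rw [pi_norm_le_iff_of_nonneg zero_le_one]
    exact hz
  rw [Subtype.dist_eq, ← hs k] at hk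
  have h1 := (ContinuousMap.dist_apply_le_dist (f := Φ q) (g := Φ (s k)) ⟨z, hzY⟩).trans_lt hk
  rwa [dist_eq_norm] at h1

lemma hull_coord {n : ℕ} (X : Set (Fin n → ℂ)) (hX : ∀ z ∈ X, ∑ i, ‖z i‖ ^ 2 = 1)
    (z : Fin n → ℂ) (hz : z ∈ polyHull X) (i : Fin n) : ‖z i‖ ≤ 1 := by
  have h := hz (MvPolynomial.X i)
  rw [eval_X] at h
  refine h.trans (Real.sSup_le ?_ zero_le_one)
  rintro _ ⟨w, hw, rfl⟩
  simp only [eval_X]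
  exact coord_le (hX w hw).le i

set_option maxHeartbeats 1000000 in
theorem stmt18 {n : ℕ} (hn : 2 ≤ n) (K : Set (Fin n → ℂ)) (hKc : IsCompact K)
    (hKb : K ⊆ euclBall n) (hpc : polyHull K = K) :
    ∃ X : Set (Fin n → ℂ), IsCompact X ∧ X ⊆ euclSphere n ∧
      K ⊆ polyHull X ∧ NoAnalyticDisk (polyHull X \ K) := by
  classical
  obtain ⟨s, hs⟩ := dense_polys n
  let c : ℕ → ℂ := TopologicalSpace.denseSeq ℂ
  have hc : DenseRange c := TopologicalSpace.denseRange_denseSeq ℂ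
  let r0 : ℕ → MvPolynomial (Fin n) ℂ := fun k =>
    C (c k.unpair.2)⁻¹ * s k.unpair.1
  let r : ℕ → MvPolynomial (Fin n) ℂ := fun k =>
    if ∀ z ∈ K, ‖eval z (r0 k)‖ ≤ 1 / 2 then r0 k else 0
  have hr : ∀ k, ∀ z ∈ K, ‖eval z (r k)‖ ≤ 1 / 2 := by
    intro k z hz
    by_cases h : ∀ z ∈ K, ‖eval z (r0 k)‖ ≤ 1 / 2
    · simp only [r, if_pos h]
      exact h z hz
    · simp only [r, if_neg h]
      simp
  choose! st hst1 hst2 hst3 using fun (f r : MvPolynomial (Fin n) ℂ)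
    (hf : ∀ z ∈ K, 0 < (eval z f).re) (hr : ∀ z ∈ K, ‖eval z r‖ ≤ 1 / 2) =>
    step_poly K hKc f r hf hr
  let F : ℕ → MvPolynomial (Fin n) ℂ := fun k => Nat.rec 1 (fun k f => st f (r k)) k
  have hF : ∀ k, ∀ z ∈ K, 0 < (eval z (F k)).re := by
    intro k
    induction k with
    | zero => intro z _; simp [F]
    | succ k ih => exact hst1 (F k) (r k) ih (hr k)
  have hF2 : ∀ k z, ∑ i, ‖z i‖ ^ 2 = 1 → 0 ≤ (eval z (F (k + 1))).re → 0 ≤ (eval z (F k)).re :=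
    fun k => hst2 (F k) (r k) (hF k) (hr k)
  have hF3 : ∀ k z, eval z (r k) = 1 → (eval z (F (k + 1))).re < 0 :=
    fun k => hst3 (F k) (r k) (hF k) (hr k)
  let Xk : ℕ → Set (Fin n → ℂ) := fun k =>
    {z | ∑ i, ‖z i‖ ^ 2 = 1} ∩ {z | 0 ≤ (eval z (F k)).re}
  have hXkcl : ∀ k, IsClosed (Xk k) := fun k =>
    (isClosed_eq continuous_sqn continuous_const).inter (isClosed_le continuous_const
      (Complex.continuous_re.comp (MvPolynomial.continuous_eval (F k))))
  let X : Set (Fin n → ℂ) := ⋂ k, Xk k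
  have hXs : ∀ z ∈ X, ∑ i, ‖z i‖ ^ 2 = 1 := fun z hz => (Set.mem_iInter.1 hz 0).1
  have hXc : IsCompact X :=
    compact_sqsphere.of_isClosed_subset (isClosed_iInter hXkcl) hXs
  have hXF : ∀ k, ∀ z ∈ X, 0 ≤ (eval z (F k)).re := fun k z hz => (Set.mem_iInter.1 hz k).2
  refine ⟨X, hXc, fun z hz => hXs z hz, ?_, ?_⟩
  · intro z0 hz0 p
    have hcl : IsClosed {z : Fin n → ℂ | ‖eval z0 p‖ ≤ ‖eval z p‖} :=
      isClosed_le continuous_const (MvPolynomial.continuous_eval p).norm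
    obtain ⟨y, hy⟩ := IsCompact.nonempty_iInter_of_sequence_nonempty_isCompact_isClosed
      (fun k => Xk k ∩ {z : Fin n → ℂ | ‖eval z0 p‖ ≤ ‖eval z p‖})
      (fun k z hz => ⟨⟨hz.1.1, hF2 k z hz.1.1 hz.1.2⟩, hz.2⟩)
      (fun k => by
        obtain ⟨z, h1, h2, h3⟩ := maxp hn (F k) p z0 (hKb hz0) (hF k z0 hz0)
        exact ⟨z, ⟨h1, h2⟩, h3⟩)
      ((compact_sqsphere.of_isClosed_subset (hXkcl 0) fun z hz => hz.1).inter_right hcl)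
      (fun k => (hXkcl k).inter hcl)
    have hyX : y ∈ X := Set.mem_iInter.2 fun k => (Set.mem_iInter.1 hy k).1
    have hyp : ‖eval z0 p‖ ≤ ‖eval y p‖ := (Set.mem_iInter.1 hy 0).2
    refine hyp.trans (le_csSup ?_ ⟨y, hyX, rfl⟩)
    exact (hXc.image (MvPolynomial.continuous_eval p).norm).bddAbove
  · intro φ hφ hφS a ha b hb
    by_contra hne
    obtain ⟨i, hi⟩ := Function.ne_iff.1 hne
    have hcoord : ∀ t ∈ ball (0:ℂ) 1, ∀ j, ‖φ t j‖ ≤ 1 := fun t ht j =>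
      hull_coord X hXs _ (hφS t ht).1 j
    have hKcoord : ∀ z ∈ K, ∀ j, ‖z j‖ ≤ 1 := fun z hz j => coord_le (le_of_lt (hKb hz)) j
    -- a polynomial separating
    obtain ⟨q1, hq1a, hq1K⟩ : ∃ q : MvPolynomial (Fin n) ℂ, eval (φ a) q = 1 ∧
        ∀ z ∈ K, ‖eval z q‖ ≤ 1 / 4 := by
      have hna : φ a ∉ polyHull K := by rw [hpc]; exact (hφS a ha).2
      simp only [polyHull, Set.mem_ofPred_eq, not_forall, not_le] at hna
      obtain ⟨q, hq⟩ := hna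
      set S := sSup ((fun w => ‖eval w q‖) '' K) with hS
      have hS0 : 0 ≤ S := Real.sSup_nonneg (by rintro _ ⟨w, _, rfl⟩; exact norm_nonneg _)
      have hpos : 0 < ‖eval (φ a) q‖ := hS0.trans_lt hq
      have hle : ∀ z ∈ K, ‖eval z q‖ ≤ S := fun z hz =>
        le_csSup (hKc.image (MvPolynomial.continuous_eval q).norm).bddAbove ⟨z, hz, rfl⟩
      obtain ⟨m, hm⟩ := exists_pow_lt_of_lt_one (show (0:ℝ) < 1 / 4 by norm_num)
        ((div_lt_one hpos).2 hq)
      refine ⟨(C (eval (φ a) q)⁻¹ * q) ^ m, ?_, fun z hz => ?_⟩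
      · rw [map_pow, map_mul, eval_C, inv_mul_cancel₀ (norm_pos_iff.1 hpos), one_pow]
      · rw [map_pow, map_mul, eval_C, norm_pow, norm_mul, norm_inv, inv_mul_eq_div]
        refine le_trans (pow_le_pow_left₀ (by positivity) ?_ m) hm.le
        exact div_le_div_of_nonneg_right (hle z hz) hpos.le
    obtain ⟨q2, hq2a, hq2b, hq2K⟩ : ∃ q : MvPolynomial (Fin n) ℂ, eval (φ a) q = 1 ∧
        eval (φ b) q ≠ 1 ∧ ∀ z ∈ K, ‖eval z q‖ ≤ 3 / 8 := by
      by_cases h : eval (φ b) q1 = 1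
      · refine ⟨q1 + C (1 / 16) * (MvPolynomial.X i - C (φ a i)), ?_, ?_, fun z hz => ?_⟩
        · simp [hq1a]
        · simp only [map_add, map_mul, map_sub, eval_C, eval_X, h]
          intro h2
          have h3 : φ b i - φ a i = 0 := by linear_combination 16 * h2
          exact hi (sub_eq_zero.1 h3).symm
        · simp only [map_add, map_mul, map_sub, eval_C, eval_X]
          have h1 := hq1K z hz
          have h2 := norm_sub_le (z i) (φ a i)
          have h3 := hKcoord z hz i
          have h4 := hcoord a ha i
          refine (norm_add_le _ _).trans ?_
          rw [norm_mul]
          norm_num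
          linarith
      · exact ⟨q1, hq1a, h, fun z hz => (hq1K z hz).trans (by norm_num)⟩
    have hd : 0 < ‖eval (φ b) q2 - 1‖ := norm_pos_iff.2 (sub_ne_zero.2 hq2b)
    obtain ⟨k, hk⟩ := hs q2 (min (‖eval (φ b) q2 - 1‖ / 2) (1 / 100)) (by positivity)
    have hka := hk (φ a) (hcoord a ha)
    have hkb := hk (φ b) (hcoord b hb)
    rw [hq2a] at hka
    have hab : eval (φ b) (s k) ≠ eval (φ a) (s k) := by
      intro h
      rw [h] at hkb
      have h1 := hka.trans_le (min_le_left _ _)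
      have h2 := hkb.trans_le (min_le_left _ _)
      have h3 := norm_sub_le (eval (φ b) q2 - eval (φ a) (s k)) (1 - eval (φ a) (s k))
      rw [sub_sub_sub_cancel_right] at h3
      linarith
    have hgan : AnalyticOnNhd ℂ (fun t => eval (φ t) (s k)) (ball 0 1) := by
      have h1 : AnalyticOnNhd ℂ φ (ball 0 1) := hφ.analyticOnNhd isOpen_ball
      exact (AnalyticOnNhd.eval_mvPolynomial (s k)).comp h1 (fun _ _ => trivial)
    have hnhds : nhds (eval (φ a) (s k)) ≤ Filter.map (fun t => eval (φ t) (s k)) (nhds a) := by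
      rcases (hgan a ha).eventually_constant_or_nhds_le_map_nhds with h | h
      · exfalso
        have := hgan.eqOn_of_preconnected_of_eventuallyEq
          (analyticOnNhd_const (v := eval (φ a) (s k)))
          (convex_ball (0:ℂ) 1).isPreconnected ha h
        exact hab (this hb)
      · exact h
    have himg : (fun t => eval (φ t) (s k)) '' ball 0 1 ∈ nhds (eval (φ a) (s k)) :=
      hnhds (Filter.image_mem_map (isOpen_ball.mem_nhds ha))
    obtain ⟨l, hl1, hl2⟩ : ∃ l, c l ∈ (fun t => eval (φ t) (s k)) '' ball 0 1 ∧
        c l ∈ ball (eval (φ a) (s k)) (1 / 100) := by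
      obtain ⟨y, hy, l, rfl⟩ := mem_closure_iff_nhds.1 (hc (eval (φ a) (s k))) _
        (Filter.inter_mem himg (ball_mem_nhds _ (show (0:ℝ) < 1 / 100 by norm_num)))
      exact ⟨l, hy⟩
    obtain ⟨t, ht, htc⟩ := hl1
    have hcn : 98 / 100 ≤ ‖c l‖ := by
      have h1 := hka.trans_le (min_le_right _ _)
      rw [mem_ball, dist_eq_norm] at hl2
      have h2 := norm_sub_norm_le (1 : ℂ) (c l)
      have h3 : ‖1 - c l‖ ≤ ‖1 - eval (φ a) (s k)‖ + ‖c l - eval (φ a) (s k)‖ := by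
        have := norm_sub_le (1 - eval (φ a) (s k)) (c l - eval (φ a) (s k))
        rwa [sub_sub_sub_cancel_right] at this
      rw [norm_one] at h2
      linarith
    have hc0 : c l ≠ 0 := norm_pos_iff.1 (by linarith)
    obtain ⟨N, hN⟩ : ∃ N : ℕ, N.unpair = (k, l) := ⟨Nat.pair k l, Nat.unpair_pair k l⟩
    have hr0 : r0 N = C (c l)⁻¹ * s k := by
      show C (c N.unpair.2)⁻¹ * s N.unpair.1 = _
      rw [hN]
    have hrK : ∀ z ∈ K, ‖eval z (r0 N)‖ ≤ 1 / 2 := by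
      intro z hz
      rw [hr0, map_mul, eval_C, norm_mul, norm_inv, inv_mul_eq_div,
        div_le_iff₀ (by linarith)]
      have h1 := (hk z (hKcoord z hz)).trans_le (min_le_right _ _)
      have h2 := hq2K z hz
      have h3 := norm_sub_norm_le (eval z (s k)) (eval z q2)
      rw [norm_sub_rev] at h3
      linarith
    have hrr : r N = C (c l)⁻¹ * s k := by
      simp only [r, if_pos hrK]
      exact hr0
    have h1 := hF3 N (φ t) (by
      rw [hrr, map_mul, eval_C]
      have htc' : eval (φ t) (s k) = c l := htc
      rw [htc', inv_mul_cancel₀ hc0])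
    have h2 := hull_re_nonneg X hXc (F (N + 1)) (hXF (N + 1)) (φ t) (hφS t ht).1
    linarith
end

section
/- Let f : S¹ → ℂ be a continuous function on the unit circle S¹ = {z ∈ ℂ : |z| = 1}, and let 𝒢_f(S¹) = {(z, f(z)) : z ∈ S¹} ⊆ ℂ². Then the following are equivalent: (1) 𝒢_f(S¹) is polynomially convex; (2) 𝒢_f(S¹)^̂ \ 𝒢_f(S¹) contains no analytic disk; (3) there is no continuous function g on the closed unit disc {z ∈ ℂ : |z| ≤ 1} that is holomorphic on the open unit disc and satisfies g|_{S¹} = f; (4) [z, f]_{S¹} = C(S¹,ℂ). -/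
open Metric

noncomputable def genAlg {X : Type*} [TopologicalSpace X] (S : Set C(X, ℂ)) : Set C(X, ℂ) :=
  closure ((Algebra.adjoin ℂ S : Subalgebra ℂ C(X, ℂ)) : Set C(X, ℂ))

/-- The graph of `f` over a subset of `ℂ`, inside `ℂ²`. -/
def graph1 (f : ℂ → ℂ) (E : Set ℂ) : Set (Fin 2 → ℂ) :=
  (fun z : ℂ => ![z, f z]) '' E

section
open scoped ComplexConjugate
open Polynomial Real Filter Topology

lemma aux_laurent (n : ℕ) (p : ℂ[X]) : ∃ p' q' : ℂ[X], ∀ w ∈ sphere (0:ℂ) 1,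
    conj w ^ n * p.eval w = p'.eval w + conj (q'.eval w) := by
  induction p using Polynomial.induction_on' with
  | add a b ha hb =>
    obtain ⟨p1, q1, h1⟩ := ha
    obtain ⟨p2, q2, h2⟩ := hb
    refine ⟨p1 + p2, q1 + q2, fun w hw => ?_⟩
    simp only [eval_add, mul_add, h1 w hw, h2 w hw, map_add]
    ring
  | monomial k c =>
    have hmul : ∀ w ∈ sphere (0:ℂ) 1, conj w * w = 1 := by
      intro w hw
      rw [mul_comm, Complex.mul_conj, Complex.normSq_eq_norm_sq]
      simp at hw
      simp [hw]
    rcases le_total n k with h | h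
    · obtain ⟨j, rfl⟩ := Nat.exists_eq_add_of_le h
      refine ⟨C c * X ^ j, 0, fun w hw => ?_⟩
      simp only [eval_monomial, eval_mul, eval_C, eval_pow, eval_X, eval_zero, map_zero, add_zero]
      calc conj w ^ n * (c * w ^ (n + j)) = (conj w * w) ^ n * (c * w ^ j) := by ring
        _ = _ := by rw [hmul w hw]; ring
    · obtain ⟨j, rfl⟩ := Nat.exists_eq_add_of_le h
      refine ⟨0, C (conj c) * X ^ j, fun w hw => ?_⟩
      simp only [eval_monomial, eval_mul, eval_C, eval_pow, eval_X, eval_zero, map_mul, map_pow,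
        Complex.conj_conj, zero_add]
      calc conj w ^ (k + j) * (c * w ^ k) = (conj w * w) ^ k * (c * conj w ^ j) := by ring
        _ = _ := by rw [hmul w hw]; ring

lemma aux_dense :
    closure ((Algebra.adjoin ℂ ({ContinuousMap.restrict (sphere (0:ℂ) 1) (.id ℂ)} ∪
      star {ContinuousMap.restrict (sphere (0:ℂ) 1) (.id ℂ)}) :
        Subalgebra ℂ C(sphere (0:ℂ) 1, ℂ)) : Set C(sphere (0:ℂ) 1, ℂ)) = Set.univ := by
  have h := ContinuousMap.elemental_id_eq_top (𝕜 := ℂ) (sphere (0:ℂ) 1)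
  have h2 := congrArg (fun S : StarSubalgebra ℂ C(sphere (0:ℂ) 1, ℂ) => (S : Set C(sphere (0:ℂ) 1, ℂ))) h
  simp only [StarAlgebra.elemental, StarSubalgebra.topologicalClosure_coe, StarSubalgebra.coe_top] at h2
  exact h2

lemma aux_approx (H : ℂ → ℂ) (hH : ContinuousOn H (sphere (0:ℂ) 1)) (ε : ℝ) (hε : 0 < ε) :
    ∃ p q : ℂ[X], ∀ w ∈ sphere (0:ℂ) 1, ‖H w - (p.eval w + conj (q.eval w))‖ ≤ ε := by
  let h : C(sphere (0:ℂ) 1, ℂ) := ⟨_, hH.domRestrict⟩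
  have hm : h ∈ closure ((Algebra.adjoin ℂ ({ContinuousMap.restrict (sphere (0:ℂ) 1) (.id ℂ)} ∪
      star {ContinuousMap.restrict (sphere (0:ℂ) 1) (.id ℂ)}) :
        Subalgebra ℂ C(sphere (0:ℂ) 1, ℂ)) : Set C(sphere (0:ℂ) 1, ℂ)) := by
    rw [aux_dense]; trivial
  obtain ⟨g, hg, hd⟩ := Metric.mem_closure_iff.1 hm ε hε
  have key : ∃ (n : ℕ) (p : ℂ[X]), ∀ w : sphere (0:ℂ) 1, g w = conj (w:ℂ) ^ n * p.eval (w:ℂ) := by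
    clear hd
    have hmul : ∀ w : sphere (0:ℂ) 1, conj (w:ℂ) * w = 1 := by
      rintro ⟨w, hw⟩
      rw [mul_comm, Complex.mul_conj, Complex.normSq_eq_norm_sq]
      simp at hw
      simp [hw]
    induction hg using Algebra.adjoin_induction with
    | mem x hx =>
      rcases hx with hx | hx
      · rw [Set.mem_singleton_iff] at hx
        subst hx
        exact ⟨0, X, fun w => by simp⟩
      · rw [Set.mem_star, Set.mem_singleton_iff, star_eq_iff_star_eq] at hx
        subst hx
        exact ⟨1, 1, fun w => by simp⟩
    | algebraMap r => exact ⟨0, C r, fun w => by simp⟩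
    | add x y _ _ hx hy =>
      obtain ⟨n, p, h1⟩ := hx
      obtain ⟨m, q, h2⟩ := hy
      refine ⟨n + m, X ^ m * p + X ^ n * q, fun w => ?_⟩
      simp only [ContinuousMap.add_apply, h1, h2, eval_add, eval_mul, eval_pow, eval_X]
      have e1 : conj (w:ℂ) ^ n * w ^ n = 1 := by rw [← mul_pow, hmul, one_pow]
      have e2 : conj (w:ℂ) ^ m * w ^ m = 1 := by rw [← mul_pow, hmul, one_pow]
      rw [pow_add]
      linear_combination (-(conj (w:ℂ) ^ n * p.eval (w:ℂ))) * e2 -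
        (conj (w:ℂ) ^ m * q.eval (w:ℂ)) * e1
    | mul x y _ _ hx hy =>
      obtain ⟨n, p, h1⟩ := hx
      obtain ⟨m, q, h2⟩ := hy
      refine ⟨n + m, p * q, fun w => ?_⟩
      simp only [ContinuousMap.mul_apply, h1, h2, eval_mul]
      ring
  obtain ⟨n, p, hp⟩ := key
  obtain ⟨p', q', h'⟩ := aux_laurent n p
  refine ⟨p', q', fun w hw => ?_⟩
  rw [← h' w hw, ← hp ⟨w, hw⟩]
  have := (ContinuousMap.dist_le hε.le).1 hd.le ⟨w, hw⟩
  rw [dist_eq_norm] at this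
  exact this

lemma aux_max (p q : ℂ[X]) (M : ℝ)
    (h : ∀ w ∈ sphere (0:ℂ) 1, ‖p.eval w + conj (q.eval w)‖ ≤ M)
    (a : ℂ) (ha : a ∈ closedBall (0:ℂ) 1) : ‖p.eval a + conj (q.eval a)‖ ≤ M := by
  set T := p.eval a + conj (q.eval a) with hT
  by_cases h0 : T = 0
  · rw [h0, norm_zero]
    exact (norm_nonneg _).trans (h 1 (by simp))
  set c : ℂ := conj T / ‖T‖ with hc
  have hn : ‖T‖ ≠ 0 := norm_ne_zero_iff.2 h0
  have hc1 : ‖c‖ = 1 := by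
    rw [hc, norm_div, RCLike.norm_conj, Complex.norm_real, norm_norm, div_self hn]
  have hre : ∀ z : ℂ, (c * p.eval z + conj c * q.eval z).re =
      (c * (p.eval z + conj (q.eval z))).re := by
    intro z; simp; ring
  have hd : Differentiable ℂ (fun z => Complex.exp (c * p.eval z + conj c * q.eval z)) := by
    fun_prop
  have := Complex.norm_le_of_forall_mem_frontier_norm_le (isBounded_ball (x := (0:ℂ)) (r := 1))
    hd.diffContOnCl (C := Real.exp M) (fun z hz => by
      rw [frontier_ball _ one_ne_zero] at hz
      rw [Complex.norm_exp, hre]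
      apply Real.exp_le_exp.2
      refine (Complex.re_le_norm _).trans ?_
      rw [norm_mul, hc1, one_mul]
      exact h z hz) (z := a) (by rwa [closure_ball _ one_ne_zero])
  rw [Complex.norm_exp, hre, Real.exp_le_exp] at this
  have e : c * (p.eval a + conj (q.eval a)) = (‖T‖ : ℂ) := by
    rw [← hT, hc, div_mul_eq_mul_div, mul_comm, Complex.mul_conj, Complex.normSq_eq_norm_sq]
    have : (‖T‖ : ℂ) ≠ 0 := by exact_mod_cast hn
    field_simp
    push_cast
    ring
  rwa [e, Complex.ofReal_re] at this

lemma aux_norm_avg (F : ℂ → ℂ) (M : ℝ) (h : ∀ w ∈ sphere (0:ℂ) 1, ‖F w‖ ≤ M) :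
    ‖circleAverage F 0 1‖ ≤ M := by
  rw [circleAverage_def, norm_smul]
  have := intervalIntegral.norm_integral_le_of_norm_le_const (a := 0) (b := 2 * π)
    (f := fun θ => F (circleMap 0 1 θ)) (C := M)
    (fun θ _ => h _ (circleMap_mem_sphere 0 zero_le_one θ))
  have hp := Real.pi_pos
  rw [sub_zero, abs_of_pos (by positivity)] at this
  rw [Real.norm_of_nonneg (by positivity), inv_mul_le_iff₀ (by positivity)]
  linarith

lemma aux_int {F : ℂ → ℂ} (h : ContinuousOn F (sphere (0:ℂ) 1)) : CircleIntegrable F 0 1 :=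
  h.circleIntegrable zero_le_one

lemma aux_mul {F G : ℂ → ℂ} {s : Set ℂ} (hF : ContinuousOn F s) (hG : ContinuousOn G s) :
    ContinuousOn (fun w => F w * G w) s := hF.mul hG

lemma aux_conj {F : ℂ → ℂ} (h : ContinuousOn F (sphere (0:ℂ) 1)) :
    circleAverage (fun w => conj (F w)) 0 1 = conj (circleAverage F 0 1) :=
  ContinuousLinearMap.circleAverage_comp_comm (Complex.conjCLE : ℂ →L[ℝ] ℂ) (aux_int h)

lemma aux_avg_close (F G φ : ℂ → ℂ) (hF : ContinuousOn F (sphere (0:ℂ) 1))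
    (hG : ContinuousOn G (sphere (0:ℂ) 1)) (hφ : ContinuousOn φ (sphere (0:ℂ) 1)) (B ε : ℝ)
    (hB : ∀ w ∈ sphere (0:ℂ) 1, ‖φ w‖ ≤ B)
    (h : ∀ w ∈ sphere (0:ℂ) 1, ‖F w - G w‖ ≤ ε) :
    ‖circleAverage (fun w => φ w * F w) 0 1 - circleAverage (fun w => φ w * G w) 0 1‖ ≤ B * ε := by
  rw [← circleAverage_fun_sub (aux_int (aux_mul hφ hF)) (aux_int (aux_mul hφ hG))]
  apply aux_norm_avg
  intro w hw
  rw [← mul_sub, norm_mul]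
  exact mul_le_mul (hB w hw) (h w hw) (norm_nonneg _) ((norm_nonneg _).trans (hB w hw))

lemma aux_ne1 {a w : ℂ} (ha : a ∈ ball (0:ℂ) 1) (hw : w ∈ closedBall (0:ℂ) 1) :
    1 - conj a * w ≠ 0 := by
  intro h
  have h1 : conj a * w = 1 := (sub_eq_zero.1 h).symm
  have h2 := congrArg norm h1
  simp at h2 ha hw
  nlinarith [norm_nonneg a, norm_nonneg w]

lemma aux_ne2 {a w : ℂ} (ha : a ∈ ball (0:ℂ) 1) (hw : w ∈ sphere (0:ℂ) 1) :
    w - a ≠ 0 := by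
  intro h
  rw [sub_eq_zero.1 h] at hw
  simp at ha hw
  linarith

lemma aux_kernel {a w : ℂ} (ha : a ∈ ball (0:ℂ) 1) (hw : w ∈ sphere (0:ℂ) 1) :
    conj (w / (w - a)) = (1 - conj a * w)⁻¹ := by
  have h1 := aux_ne1 ha (sphere_subset_closedBall hw)
  have h2 := aux_ne2 ha hw
  have hmul : conj w * w = 1 := by
    rw [mul_comm, Complex.mul_conj, Complex.normSq_eq_norm_sq]
    simp at hw
    simp [hw]
  have h3 : conj w - conj a ≠ 0 := by
    rw [← map_sub]; exact (_root_.map_ne_zero _).2 h2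
  rw [map_div₀, map_sub, div_eq_iff h3, inv_mul_eq_div, eq_div_iff h1]
  linear_combination (-conj a) * hmul

lemma aux_cauchy (p : ℂ[X]) {a : ℂ} (ha : a ∈ ball (0:ℂ) 1) :
    circleAverage (fun w => w / (w - a) * p.eval w) 0 1 = p.eval a := by
  have := DiffContOnCl.circleAverage_smul_div (f := fun w => p.eval w) (c := 0) (R := 1) (w := a)
    (p.differentiable.diffContOnCl) (by simpa using ha)
  simpa using this

lemma aux_mean (p : ℂ[X]) {a : ℂ} (ha : a ∈ ball (0:ℂ) 1) :
    circleAverage (fun w => (1 - conj a * w)⁻¹ * p.eval w) 0 1 = p.eval 0 := by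
  have := DiffContOnCl.circleAverage (f := fun w => (1 - conj a * w)⁻¹ * p.eval w)
    (c := 0) (R := 1) (by
      apply DifferentiableOn.diffContOnCl
      rw [abs_one, closure_ball _ one_ne_zero]
      apply DifferentiableOn.mul
      · apply DifferentiableOn.inv (by fun_prop)
        intro w hw
        exact aux_ne1 ha hw
      · exact p.differentiable.differentiableOn)
  simpa using this

lemma aux_cont1 {a : ℂ} (ha : a ∈ ball (0:ℂ) 1) :
    ContinuousOn (fun w => (1 - conj a * w)⁻¹) (sphere (0:ℂ) 1) :=
  ContinuousOn.inv₀ (by fun_prop) (fun w hw => aux_ne1 ha (sphere_subset_closedBall hw))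

lemma aux_cont2 {a : ℂ} (ha : a ∈ ball (0:ℂ) 1) :
    ContinuousOn (fun w => w / (w - a)) (sphere (0:ℂ) 1) :=
  ContinuousOn.div (by fun_prop) (by fun_prop) (fun w hw => aux_ne2 ha hw)

lemma aux_cauchy' (p q : ℂ[X]) {a : ℂ} (ha : a ∈ ball (0:ℂ) 1) :
    circleAverage (fun w => w / (w - a) * (p.eval w + conj (q.eval w))) 0 1 =
      p.eval a + conj (q.eval 0) := by
  have hp : ContinuousOn (fun w => p.eval w) (sphere (0:ℂ) 1) := p.continuous.continuousOn
  have hq : ContinuousOn (fun w => q.eval w) (sphere (0:ℂ) 1) := q.continuous.continuousOn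
  have hq' : ContinuousOn (fun w => conj (q.eval w)) (sphere (0:ℂ) 1) :=
    Complex.continuous_conj.comp_continuousOn hq
  simp only [mul_add]
  rw [circleAverage_fun_add (aux_int (aux_mul (aux_cont2 ha) hp)) (aux_int (aux_mul (aux_cont2 ha) hq')),
    aux_cauchy p ha, ← aux_mean q ha, ← aux_conj (aux_mul (aux_cont1 ha) hq)]
  congr 1
  apply circleAverage_congr_sphere
  intro w hw
  rw [abs_one] at hw
  simp only [map_mul]
  rw [← aux_kernel ha hw, Complex.conj_conj]

lemma aux_mean' (p q : ℂ[X]) {a : ℂ} (ha : a ∈ ball (0:ℂ) 1) :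
    circleAverage (fun w => (1 - conj a * w)⁻¹ * (p.eval w + conj (q.eval w))) 0 1 =
      p.eval 0 + conj (q.eval a) := by
  have hp : ContinuousOn (fun w => p.eval w) (sphere (0:ℂ) 1) := p.continuous.continuousOn
  have hq : ContinuousOn (fun w => q.eval w) (sphere (0:ℂ) 1) := q.continuous.continuousOn
  have hq' : ContinuousOn (fun w => conj (q.eval w)) (sphere (0:ℂ) 1) :=
    Complex.continuous_conj.comp_continuousOn hq
  simp only [mul_add]
  rw [circleAverage_fun_add (aux_int (aux_mul (aux_cont1 ha) hp)) (aux_int (aux_mul (aux_cont1 ha) hq')),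
    aux_mean p ha, ← aux_cauchy q ha, ← aux_conj (aux_mul (aux_cont2 ha) hq)]
  congr 1
  apply circleAverage_congr_sphere
  intro w hw
  rw [abs_one] at hw
  simp only [map_mul]
  rw [← aux_kernel ha hw]

lemma aux_holo (f : ℂ → ℂ) (hf : ContinuousOn f (sphere (0:ℂ) 1)) :
    DifferentiableOn ℂ (fun a => circleAverage (fun w => w / (w - a) * f w) 0 1)
      (ball (0:ℂ) 1) := by
  have h1 := (hasFPowerSeriesOn_cauchy_integral (R := 1) (c := 0) (f := f)
    (by simpa using aux_int hf) one_pos).differentiableOn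
  have e : eball (0:ℂ) ((1 : NNReal) : ENNReal) = ball (0:ℂ) 1 := by
    rw [Metric.eball_coe]; simp
  rw [e] at h1
  refine h1.congr fun a ha => ?_
  rw [circleAverage_eq_circleIntegral one_ne_zero]
  simp only [NNReal.coe_one]
  congr 1
  apply circleIntegral.integral_congr zero_le_one
  intro w hw
  have hw0 : w ≠ 0 := by rintro rfl; simp at hw
  have := aux_ne2 ha hw
  simp only [smul_eq_mul, sub_zero]
  field_simp

lemma aux_bdd {F : ℂ → ℂ} (h : ContinuousOn F (sphere (0:ℂ) 1)) :
    ∃ B : ℝ, ∀ w ∈ sphere (0:ℂ) 1, ‖F w‖ ≤ B :=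
  (isCompact_sphere (0:ℂ) 1).exists_bound_of_continuousOn h

lemma aux_lim (f φ : ℂ → ℂ) (hf : ContinuousOn f (sphere (0:ℂ) 1))
    (hφ : ContinuousOn φ (sphere (0:ℂ) 1)) (T : ℕ → ℂ → ℂ)
    (hT : ∀ k, ContinuousOn (T k) (sphere (0:ℂ) 1))
    (h : ∀ k, ∀ w ∈ sphere (0:ℂ) 1, ‖f w - T k w‖ ≤ 1 / ((k:ℝ) + 1)) :
    Tendsto (fun k => circleAverage (fun w => φ w * T k w) 0 1) atTop
      (𝓝 (circleAverage (fun w => φ w * f w) 0 1)) := by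
  obtain ⟨B, hB⟩ := aux_bdd hφ
  rw [tendsto_iff_norm_sub_tendsto_zero]
  have h0 : Tendsto (fun k : ℕ => B * (1 / ((k:ℝ) + 1))) atTop (𝓝 0) := by
    simpa using (tendsto_one_div_add_atTop_nhds_zero_nat (𝕜 := ℝ)).const_mul B
  refine squeeze_zero (fun _ => norm_nonneg _) (fun k => ?_) h0
  refine aux_avg_close _ _ _ (hT k) hf hφ B _ hB fun w hw => ?_
  rw [norm_sub_rev]
  exact h k w hw

lemma aux_extend (f : ℂ → ℂ) (hf : ContinuousOn f (sphere (0:ℂ) 1))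
    (hB : ∀ a ∈ ball (0:ℂ) 1, circleAverage (fun w => (1 - conj a * w)⁻¹ * f w) 0 1 =
      circleAverage f 0 1) :
    ∃ g : ℂ → ℂ, ContinuousOn g (closedBall (0:ℂ) 1) ∧
            DifferentiableOn ℂ g (ball (0:ℂ) 1) ∧ ∀ z ∈ sphere (0:ℂ) 1, g z = f z := by
  choose p q hpq using fun k : ℕ => aux_approx f hf (1 / ((k:ℝ) + 1)) (by positivity)
  set T : ℕ → ℂ → ℂ := fun k w => (p k).eval w + conj ((q k).eval w) with hT
  have hTc : ∀ k, Continuous (T k) := fun k =>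
    (p k).continuous.add (Complex.continuous_conj.comp (q k).continuous)
  have hlim0 := tendsto_one_div_add_atTop_nhds_zero_nat (𝕜 := ℝ)
  have hdiff : ∀ k l, ∀ a ∈ closedBall (0:ℂ) 1,
      ‖T k a - T l a‖ ≤ 1 / ((k:ℝ) + 1) + 1 / ((l:ℝ) + 1) := by
    intro k l a ha
    have e : ∀ z, T k z - T l z = (p k - p l).eval z + conj ((q k - q l).eval z) := by
      intro z; simp [hT]; ring
    rw [e]
    refine aux_max _ _ _ (fun w hw => ?_) a ha
    rw [← e]
    calc ‖T k w - T l w‖ = ‖(f w - T l w) - (f w - T k w)‖ := by congr 1; ring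
      _ ≤ ‖f w - T l w‖ + ‖f w - T k w‖ := norm_sub_le _ _
      _ ≤ _ := by linarith [hpq k w hw, hpq l w hw]
  have hUC : UniformCauchySeqOn T atTop (closedBall (0:ℂ) 1) := by
    rw [Metric.uniformCauchySeqOn_iff]
    intro ε hε
    obtain ⟨N, hN⟩ := (hlim0.eventually (gt_mem_nhds (half_pos hε))).exists_forall_of_atTop
    refine ⟨N, fun m hm n hn x hx => ?_⟩
    rw [dist_eq_norm]
    linarith [hdiff m n x hx, hN m hm, hN n hn]
  have hex : ∀ a, ∃ u, a ∈ closedBall (0:ℂ) 1 → Tendsto (fun k => T k a) atTop (𝓝 u) := by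
    intro a
    by_cases ha : a ∈ closedBall (0:ℂ) 1
    · obtain ⟨u, hu⟩ := cauchySeq_tendsto_of_complete (hUC.cauchySeq ha)
      exact ⟨u, fun _ => hu⟩
    · exact ⟨0, fun h => absurd h ha⟩
  choose U hU using hex
  have hUU := hUC.tendstoUniformlyOn_of_tendsto (fun a ha => hU a ha)
  refine ⟨U, hUU.continuousOn (Frequently.of_forall fun k => (hTc k).continuousOn), ?_, ?_⟩
  · refine (aux_holo f hf).congr fun a ha => ?_
    have h0 : (0:ℂ) ∈ ball (0:ℂ) 1 := by simp
    have l1 := aux_lim f _ hf (aux_cont2 ha) T (fun k => (hTc k).continuousOn) hpq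
    have l2 := aux_lim f _ hf (aux_cont1 ha) T (fun k => (hTc k).continuousOn) hpq
    have l3 := aux_lim f _ hf (aux_cont1 h0) T (fun k => (hTc k).continuousOn) hpq
    have l4 := (l1.add l2).sub l3
    rw [hB a ha, hB 0 h0, add_sub_cancel_right] at l4
    refine tendsto_nhds_unique (hU a (ball_subset_closedBall ha)) (l4.congr fun k => ?_)
    simp only [hT]
    rw [aux_cauchy' _ _ ha, aux_mean' _ _ ha, aux_mean' _ _ h0]
    ring
  · intro z hz
    refine tendsto_nhds_unique (hU z (sphere_subset_closedBall hz)) ?_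
    rw [tendsto_iff_norm_sub_tendsto_zero]
    refine squeeze_zero (fun _ => norm_nonneg _) (fun k => ?_) hlim0
    rw [norm_sub_rev]
    exact hpq k z hz

lemma le_of_sq_le_sq_aux {a b : ℝ} (h : a ^ 2 ≤ b ^ 2) (hb : 0 ≤ b) : a ≤ b :=
  (le_abs_self a).trans (abs_le_of_sq_le_sq h hb)

lemma aux_cohen (H : ℂ → ℂ) (hH : ContinuousOn H (sphere (0:ℂ) 1))
    (hm : circleAverage (fun w => w * H w) 0 1 ≠ 0) :
    ∃ (c : ℂ) (r : ℂ[X]) (δ : ℝ), 0 < δ ∧ ∀ w ∈ sphere (0:ℂ) 1,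
      ‖(1 + δ : ℂ) - δ * (w * (c * H w - r.eval w))‖ ≤ 1 + δ / 2 := by
  set m := circleAverage (fun w => w * H w) 0 1 with hmdef
  set F : ℂ → ℂ := fun w => m⁻¹ * (w * H w) with hF
  have hFc : ContinuousOn F (sphere (0:ℂ) 1) :=
    aux_mul continuousOn_const (aux_mul continuousOn_id hH)
  have hFm : circleAverage F 0 1 = 1 := by
    have : circleAverage F 0 1 = m⁻¹ * m := by
      rw [hmdef]
      exact circleAverage_fun_smul (a := m⁻¹) (f := fun w => w * H w)
    rw [this, inv_mul_cancel₀ hm]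
  obtain ⟨p, q, hpq⟩ := aux_approx F hFc (1/8) (by norm_num)
  have hq : Continuous fun w => conj (q.eval w) := Complex.continuous_conj.comp q.continuous
  have h0 : ‖1 - (p.eval 0 + conj (q.eval 0))‖ ≤ 1/8 := by
    have := aux_avg_close F (fun w => p.eval w + conj (q.eval w)) (fun w => (1 - conj 0 * w)⁻¹) hFc
      (p.continuous.add hq).continuousOn (aux_cont1 (by simp)) 1 (1/8) (by simp) hpq
    rw [aux_mean' p q (by simp)] at this
    simp only [map_zero, zero_mul, sub_zero, inv_one, one_mul] at this
    rwa [hFm] at this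
  obtain ⟨B, hB⟩ := aux_bdd q.continuous.continuousOn
  set D : ℝ := 2 * (B + ‖q.eval 0‖) with hD
  have hB0 : 0 ≤ B := (norm_nonneg _).trans (hB 1 (by simp))
  set δ : ℝ := 1 / (2 * (D ^ 2 + 1)) with hδ
  have hδ0 : 0 < δ := by positivity
  have hδD : δ * D ^ 2 ≤ 1 / 2 := by
    rw [hδ, div_mul_eq_mul_div, div_le_iff₀ (by positivity)]
    nlinarith [sq_nonneg D]
  refine ⟨m⁻¹, p.divX + q.divX, δ, hδ0, fun w hw => ?_⟩
  have hpx : p.eval w = w * p.divX.eval w + p.eval 0 := by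
    conv_lhs => rw [← Polynomial.X_mul_divX_add p]
    simp [Polynomial.coeff_zero_eq_eval_zero]
  have hqx : q.eval w = w * q.divX.eval w + q.eval 0 := by
    conv_lhs => rw [← Polynomial.X_mul_divX_add q]
    simp [Polynomial.coeff_zero_eq_eval_zero]
  set Q : ℂ := q.eval w - q.eval 0 with hQ
  have hQB : |Q.im| ≤ B + ‖q.eval 0‖ :=
    (Complex.abs_im_le_norm _).trans ((norm_sub_le _ _).trans (by linarith [hB w hw]))
  set e1 : ℂ := F w - (p.eval w + conj (q.eval w)) with he1
  set e0 : ℂ := 1 - (p.eval 0 + conj (q.eval 0)) with he0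
  have hne1 : ‖e1‖ ≤ 1/8 := hpq w hw
  have hconj : conj Q - Q = -(2 * Q.im) * Complex.I := by
    apply Complex.ext <;> simp; ring
  have key : (1 + δ : ℂ) - δ * (w * (m⁻¹ * H w - (p.divX + q.divX).eval w)) =
      (1 + (2 * δ * Q.im : ℝ) * Complex.I) - δ * (e1 - e0) := by
    have : w * (m⁻¹ * H w - (p.divX + q.divX).eval w) = 1 + (conj Q - Q) + (e1 - e0) := by
      simp only [hQ, he1, he0, hF, eval_add, map_sub]
      linear_combination hpx + hqx
    rw [this, hconj]
    push_cast
    ring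
  rw [key]
  have hsq : ‖(1 + (2 * δ * Q.im : ℝ) * Complex.I : ℂ)‖ ≤ 1 + δ / 4 := by
    have h1 : ‖(1 + (2 * δ * Q.im : ℝ) * Complex.I : ℂ)‖ ^ 2 = 1 + (2 * δ * Q.im) ^ 2 := by
      rw [← Complex.normSq_eq_norm_sq, Complex.normSq_apply]
      simp; ring
    have h2 : (2 * Q.im) ^ 2 ≤ D ^ 2 := by
      rw [hD, mul_pow, mul_pow, ← sq_abs Q.im]
      have := pow_le_pow_left₀ (abs_nonneg Q.im) hQB 2
      linarith
    refine le_of_sq_le_sq_aux ?_ (by positivity)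
    rw [h1]
    have h3 : δ ^ 2 * (2 * Q.im) ^ 2 ≤ δ ^ 2 * D ^ 2 :=
      mul_le_mul_of_nonneg_left h2 (by positivity)
    have h4 : δ * (δ * D ^ 2) ≤ δ * (1 / 2) := mul_le_mul_of_nonneg_left hδD hδ0.le
    nlinarith [sq_nonneg δ]
  calc _ ≤ _ := norm_sub_le _ _
    _ ≤ (1 + δ / 4) + δ * (1/8 + 1/8) := by
      apply add_le_add hsq
      rw [norm_mul, Complex.norm_real, Real.norm_of_nonneg hδ0.le]
      exact mul_le_mul_of_nonneg_left ((norm_sub_le _ _).trans (add_le_add hne1 h0)) hδ0.le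
    _ = _ := by ring

lemma aux_unit (S : Subalgebra ℂ C(sphere (0:ℂ) 1, ℂ))
    (hS : IsClosed (S : Set C(sphere (0:ℂ) 1, ℂ))) (x : C(sphere (0:ℂ) 1, ℂ)) (hx : x ∈ S)
    (hn : ‖x‖ < 1) : ∃ y ∈ S, (1 - x) * y = 1 := by
  have : CompleteSpace S := hS.completeSpace_coe
  have h := isUnit_one_sub_of_norm_lt_one (x := (⟨x, hx⟩ : S)) hn
  obtain ⟨y, hy⟩ := h.exists_right_inv
  exact ⟨y, y.2, congrArg Subtype.val hy⟩

lemma aux_top (S : Subalgebra ℂ C(sphere (0:ℂ) 1, ℂ))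
    (hS : IsClosed (S : Set C(sphere (0:ℂ) 1, ℂ)))
    (hz : ContinuousMap.restrict (sphere (0:ℂ) 1) (.id ℂ) ∈ S)
    (v : C(sphere (0:ℂ) 1, ℂ)) (hv : v ∈ S) (h : ∀ w : sphere (0:ℂ) 1, (w:ℂ) * v w = 1) :
    (S : Set C(sphere (0:ℂ) 1, ℂ)) = Set.univ := by
  have hvs : v = star (ContinuousMap.restrict (sphere (0:ℂ) 1) (.id ℂ)) := by
    ext w
    have h1 := h w
    have hmul : conj (w:ℂ) * w = 1 := by
      rw [mul_comm, Complex.mul_conj, Complex.normSq_eq_norm_sq]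
      have hw := w.2
      simp at hw
      simp [hw]
    have : v w = conj (w:ℂ) := by linear_combination conj (w:ℂ) * h1 - v w * hmul
    simpa using this
  apply Set.eq_univ_of_univ_subset
  rw [← aux_dense]
  refine closure_minimal ?_ hS
  refine Algebra.adjoin_le ?_
  rintro x (hx | hx)
  · rw [Set.mem_singleton_iff] at hx
    rw [hx]; exact hz
  · rw [Set.mem_star, Set.mem_singleton_iff, star_eq_iff_star_eq] at hx
    rw [← hx, ← hvs]; exact hv

lemma aux_wermer (S : Subalgebra ℂ C(sphere (0:ℂ) 1, ℂ))
    (hS : IsClosed (S : Set C(sphere (0:ℂ) 1, ℂ)))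
    (hz : ContinuousMap.restrict (sphere (0:ℂ) 1) (.id ℂ) ∈ S)
    (f : ℂ → ℂ) (hf : ContinuousOn f (sphere (0:ℂ) 1))
    (hfS : (⟨_, hf.domRestrict⟩ : C(sphere (0:ℂ) 1, ℂ)) ∈ S)
    (hno : ¬ ∃ g : ℂ → ℂ, ContinuousOn g (closedBall (0:ℂ) 1) ∧
            DifferentiableOn ℂ g (ball (0:ℂ) 1) ∧ ∀ z ∈ sphere (0:ℂ) 1, g z = f z) :
    (S : Set C(sphere (0:ℂ) 1, ℂ)) = Set.univ := by
  have hno' := mt (aux_extend f hf) hno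
  push Not at hno'
  obtain ⟨a, ha, hne⟩ := hno'
  set Z : C(sphere (0:ℂ) 1, ℂ) := ContinuousMap.restrict (sphere (0:ℂ) 1) (.id ℂ) with hZ
  have hZw : ∀ w, Z w = (w : ℂ) := fun w => rfl
  set H : ℂ → ℂ := fun w => (1 - conj a * w)⁻¹ * f w with hHdef
  have hH : ContinuousOn H (sphere (0:ℂ) 1) := aux_mul (aux_cont1 ha) hf
  have hHS : (⟨_, hH.domRestrict⟩ : C(sphere (0:ℂ) 1, ℂ)) ∈ S := by
    obtain ⟨y, hyS, hy⟩ := aux_unit S hS (conj a • Z) (S.smul_mem hz _) (by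
      simp only [mem_ball, dist_zero_right] at ha
      rw [norm_smul, RCLike.norm_conj]
      have : ‖Z‖ ≤ 1 := by
        rw [ContinuousMap.norm_le _ zero_le_one]
        intro w
        have := w.2
        rw [mem_sphere_zero_iff_norm] at this
        rw [hZw, this]
      nlinarith [norm_nonneg a, norm_nonneg Z])
    have : (⟨_, hH.domRestrict⟩ : C(sphere (0:ℂ) 1, ℂ)) = y * ⟨_, hf.domRestrict⟩ := by
      ext w
      have h1 := congrArg (fun g : C(sphere (0:ℂ) 1, ℂ) => g w) hy
      simp only [ContinuousMap.mul_apply, ContinuousMap.sub_apply, ContinuousMap.one_apply,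
        ContinuousMap.smul_apply, smul_eq_mul, hZw] at h1
      have h2 : y w = (1 - conj a * (w:ℂ))⁻¹ := eq_inv_of_mul_eq_one_right h1
      simp [hHdef, h2]
    rw [this]
    exact S.mul_mem hyS hfS
  have hm : circleAverage (fun w => w * H w) 0 1 ≠ 0 := by
    intro h0
    apply hne
    have e : circleAverage H 0 1 = circleAverage (fun w => f w + conj a • (w * H w)) 0 1 := by
      apply circleAverage_congr_sphere
      intro w hw
      rw [abs_one] at hw
      have := aux_ne1 ha (sphere_subset_closedBall hw)
      simp only [hHdef, smul_eq_mul]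
      field_simp
      ring
    rw [e, circleAverage_fun_add (aux_int hf)
      (aux_int (F := fun w => conj a • (w * H w))
        (aux_mul continuousOn_const (aux_mul continuousOn_id hH))),
      circleAverage_fun_smul, h0, smul_zero, add_zero]
  obtain ⟨c, r, δ, hδ, hb⟩ := aux_cohen H hH hm
  set W : C(sphere (0:ℂ) 1, ℂ) := c • ⟨_, hH.domRestrict⟩ - Polynomial.aeval Z r with hW
  have hWS : W ∈ S := by
    refine S.sub_mem (S.smul_mem hHS _) ?_
    exact Algebra.adjoin_le (by simpa using hz) (Polynomial.aeval_mem_adjoin_singleton ℂ Z)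
  have hWw : ∀ w : sphere (0:ℂ) 1, W w = c * H w - r.eval (w:ℂ) := by
    intro w
    simp [hW, Polynomial.aeval_continuousMap_apply, hZw]
  have hδc : (1 + δ : ℂ) ≠ 0 := by
    have : (1 + δ : ℝ) ≠ 0 := by positivity
    exact_mod_cast this
  obtain ⟨y, hyS, hy⟩ := aux_unit S hS (1 - (δ / (1 + δ) : ℂ) • (Z * W))
    (S.sub_mem S.one_mem (S.smul_mem (S.mul_mem hz hWS) _)) (by
      have : ‖(1 - (δ / (1 + δ) : ℂ) • (Z * W) : C(sphere (0:ℂ) 1, ℂ))‖ ≤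
          (1 + δ / 2) / (1 + δ) := by
        rw [ContinuousMap.norm_le _ (by positivity)]
        intro w
        have h1 := hb w w.2
        rw [← hWw w] at h1
        have h2 : (1 - (δ / (1 + δ) : ℂ) • (Z * W) : C(sphere (0:ℂ) 1, ℂ)) w =
            ((1 + δ : ℂ) - δ * (w * W w)) / (1 + δ) := by
          simp only [ContinuousMap.sub_apply, ContinuousMap.one_apply, ContinuousMap.smul_apply,
            ContinuousMap.mul_apply, smul_eq_mul, hZw]
          field_simp
        have h3 : ‖(1 + δ : ℂ)‖ = 1 + δ := by
          have := Complex.norm_real (1 + δ)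
          rw [Real.norm_of_nonneg (by positivity)] at this
          exact_mod_cast this
        rw [h2, norm_div, h3]
        gcongr
      refine this.trans_lt ?_
      rw [div_lt_one (by positivity)]
      linarith)
  refine aux_top S hS hz ((δ / (1 + δ) : ℂ) • (W * y)) (S.smul_mem (S.mul_mem hWS hyS) _) ?_
  intro w
  have h1 := congrArg (fun g : C(sphere (0:ℂ) 1, ℂ) => g w) hy
  simp only [sub_sub_cancel, ContinuousMap.mul_apply, ContinuousMap.one_apply,
    ContinuousMap.smul_apply, smul_eq_mul, hZw] at h1 ⊢
  linear_combination h1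

end

lemma aux_mvdiff (p : MvPolynomial (Fin 2) ℂ) :
    Differentiable ℂ (fun x : Fin 2 → ℂ => MvPolynomial.eval x p) := by
  induction p using MvPolynomial.induction_on with
  | C a => simp
  | add p q hp hq =>
    simp only [map_add]
    exact hp.add hq
  | mul_X p i hp =>
    simp only [map_mul, MvPolynomial.eval_X]
    exact hp.mul (by fun_prop)

lemma aux_graph_compact (f : ℂ → ℂ) (hf : ContinuousOn f (sphere (0:ℂ) 1)) :
    IsCompact (graph1 f (sphere (0:ℂ) 1)) := by
  apply (isCompact_sphere (0:ℂ) 1).image_of_continuousOn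
  rw [continuousOn_pi]
  intro i
  fin_cases i
  · exact continuousOn_id
  · exact hf

lemma aux_graph_bdd (f : ℂ → ℂ) (hf : ContinuousOn f (sphere (0:ℂ) 1))
    (p : MvPolynomial (Fin 2) ℂ) :
    BddAbove ((fun w => ‖MvPolynomial.eval w p‖) '' graph1 f (sphere (0:ℂ) 1)) :=
  (aux_graph_compact f hf).bddAbove_image (aux_mvdiff p).continuous.norm.continuousOn

lemma aux_two_three (f : ℂ → ℂ) (hf : ContinuousOn f (sphere (0:ℂ) 1))
    (h : NoAnalyticDisk (polyHull (graph1 f (sphere (0:ℂ) 1)) \ graph1 f (sphere (0:ℂ) 1))) :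
    ¬ ∃ g : ℂ → ℂ, ContinuousOn g (closedBall (0:ℂ) 1) ∧
            DifferentiableOn ℂ g (ball (0:ℂ) 1) ∧ ∀ z ∈ sphere (0:ℂ) 1, g z = f z := by
  rintro ⟨g, hgc, hgd, hgf⟩
  have hcl : closure (ball (0:ℂ) 1) = closedBall 0 1 := closure_ball _ one_ne_zero
  have hφd : DifferentiableOn ℂ (fun z : ℂ => ![z, g z]) (ball (0:ℂ) 1) := by
    rw [differentiableOn_pi]
    intro i
    fin_cases i
    · exact differentiableOn_id
    · exact hgd
  have hφc : ContinuousOn (fun z : ℂ => ![z, g z]) (closure (ball (0:ℂ) 1)) := by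
    rw [continuousOn_pi, hcl]
    intro i
    fin_cases i
    · exact continuousOn_id
    · exact hgc
  have := h _ hφd (fun z hz => ?_) 0 (by simp) (1/2) (by simp; norm_num)
  · have := congrFun this 0
    simp at this
  · constructor
    · intro p
      refine Complex.norm_le_of_forall_mem_frontier_norm_le (isBounded_ball (x := (0:ℂ)) (r := 1))
        ((aux_mvdiff p).comp_diffContOnCl ⟨hφd, hφc⟩) (fun w hw => ?_) (subset_closure hz)
      rw [frontier_ball _ one_ne_zero] at hw
      apply le_csSup (aux_graph_bdd f hf p)
      refine ⟨![w, f w], ⟨w, hw, rfl⟩, ?_⟩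
      simp [hgf w hw]
    · rintro ⟨w, hw, hwz⟩
      have := congrFun hwz 0
      simp at this hw hz
      rw [this] at hw
      linarith

lemma aux_four_one (f : ℂ → ℂ) (hf : ContinuousOn f (sphere (0:ℂ) 1))
    (h : genAlg {g : C(sphere (0:ℂ) 1, ℂ) |
            (∀ z : sphere (0:ℂ) 1, g z = (z : ℂ)) ∨
            (∀ z : sphere (0:ℂ) 1, g z = f (z : ℂ))} = Set.univ) :
    polyHull (graph1 f (sphere (0:ℂ) 1)) = graph1 f (sphere (0:ℂ) 1) := by
  apply Set.Subset.antisymm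
  swap
  · intro x hx p
    exact le_csSup (aux_graph_bdd f hf p) ⟨x, hx, rfl⟩
  intro x hx
  by_contra hxn
  have happ : ∀ (H : ℂ → ℂ) (_ : ContinuousOn H (sphere (0:ℂ) 1)) (η : ℝ), 0 < η →
      ∃ P : MvPolynomial (Fin 2) ℂ, ∀ z ∈ sphere (0:ℂ) 1,
        ‖H z - MvPolynomial.eval ![z, f z] P‖ ≤ η := by
    intro H hH η hη
    have hm : (⟨_, hH.domRestrict⟩ : C(sphere (0:ℂ) 1, ℂ)) ∈ genAlg {g : C(sphere (0:ℂ) 1, ℂ) |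
            (∀ z : sphere (0:ℂ) 1, g z = (z : ℂ)) ∨
            (∀ z : sphere (0:ℂ) 1, g z = f (z : ℂ))} := by
      rw [h]; trivial
    obtain ⟨g, hg, hd⟩ := Metric.mem_closure_iff.1 hm η hη
    have key : ∃ P : MvPolynomial (Fin 2) ℂ, ∀ z : sphere (0:ℂ) 1,
        g z = MvPolynomial.eval ![(z:ℂ), f z] P := by
      clear hd
      induction hg using Algebra.adjoin_induction with
      | mem x hx =>
        rcases hx with hx | hx
        · exact ⟨MvPolynomial.X 0, fun z => by simp [hx]⟩
        · exact ⟨MvPolynomial.X 1, fun z => by simp [hx]⟩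
      | algebraMap r => exact ⟨MvPolynomial.C r, fun w => by simp⟩
      | add x y _ _ hx hy =>
        obtain ⟨p, h1⟩ := hx
        obtain ⟨q, h2⟩ := hy
        exact ⟨p + q, fun z => by simp [h1, h2]⟩
      | mul x y _ _ hx hy =>
        obtain ⟨p, h1⟩ := hx
        obtain ⟨q, h2⟩ := hy
        exact ⟨p * q, fun z => by simp [h1, h2]⟩
    obtain ⟨P, hP⟩ := key
    refine ⟨P, fun z hz => ?_⟩
    rw [← hP ⟨z, hz⟩]
    have := (ContinuousMap.dist_le hη.le).1 hd.le ⟨z, hz⟩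
    rw [dist_eq_norm] at this
    exact this
  set N : ℂ → ℂ := fun z => (starRingEnd ℂ) (z - x 0) * (z - x 0) +
    (starRingEnd ℂ) (f z - x 1) * (f z - x 1) with hN
  have hN0 : ∀ z ∈ sphere (0:ℂ) 1, N z ≠ 0 := by
    intro z hz h0
    apply hxn
    refine ⟨z, hz, ?_⟩
    have h1 : N z = ((‖z - x 0‖ ^ 2 + ‖f z - x 1‖ ^ 2 : ℝ) : ℂ) := by
      simp only [hN, Complex.conj_mul']
      push_cast
      ring
    rw [h1] at h0
    have h2 : ‖z - x 0‖ ^ 2 + ‖f z - x 1‖ ^ 2 = 0 := by exact_mod_cast h0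
    have h3 : ‖z - x 0‖ = 0 := by
      have : ‖z - x 0‖ ^ 2 = 0 := by nlinarith [sq_nonneg ‖z - x 0‖, sq_nonneg ‖f z - x 1‖]
      exact pow_eq_zero_iff (two_ne_zero) |>.1 this
    have h4 : ‖f z - x 1‖ = 0 := by
      have : ‖f z - x 1‖ ^ 2 = 0 := by nlinarith [sq_nonneg ‖z - x 0‖, sq_nonneg ‖f z - x 1‖]
      exact pow_eq_zero_iff (two_ne_zero) |>.1 this
    rw [norm_eq_zero, sub_eq_zero] at h3 h4
    ext i
    fin_cases i
    · exact h3
    · exact h4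
  have c0 : ContinuousOn (fun z : ℂ => z - x 0) (sphere (0:ℂ) 1) := by fun_prop
  have c1 : ContinuousOn (fun z : ℂ => f z - x 1) (sphere (0:ℂ) 1) := hf.sub continuousOn_const
  have c0' := Complex.continuous_conj.comp_continuousOn c0
  have c1' := Complex.continuous_conj.comp_continuousOn c1
  have cN : ContinuousOn N (sphere (0:ℂ) 1) := (c0'.mul c0).add (c1'.mul c1)
  obtain ⟨B0, hB0⟩ := (isCompact_sphere (0:ℂ) 1).exists_bound_of_continuousOn c0
  obtain ⟨B1, hB1⟩ := (isCompact_sphere (0:ℂ) 1).exists_bound_of_continuousOn c1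
  have hb0 : 0 ≤ B0 := (norm_nonneg _).trans (hB0 1 (by simp))
  have hb1 : 0 ≤ B1 := (norm_nonneg _).trans (hB1 1 (by simp))
  set η : ℝ := 1 / (2 * (B0 + B1 + 1)) with hη
  have hη0 : 0 < η := by positivity
  obtain ⟨P, hP⟩ := happ (fun z => (starRingEnd ℂ) (z - x 0) / N z) (c0'.div cN hN0) η hη0
  obtain ⟨Q, hQ⟩ := happ (fun z => (starRingEnd ℂ) (f z - x 1) / N z) (c1'.div cN hN0) η hη0
  have hfin := hx (1 - (MvPolynomial.X 0 - MvPolynomial.C (x 0)) * P -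
    (MvPolynomial.X 1 - MvPolynomial.C (x 1)) * Q)
  have hle : sSup ((fun w => ‖MvPolynomial.eval w (1 - (MvPolynomial.X 0 -
      MvPolynomial.C (x 0)) * P - (MvPolynomial.X 1 - MvPolynomial.C (x 1)) * Q)‖) ''
        graph1 f (sphere (0:ℂ) 1)) ≤ 1 / 2 := by
    have hne : (graph1 f (sphere (0:ℂ) 1)).Nonempty := ⟨_, 1, by simp, rfl⟩
    apply csSup_le (hne.image _)
    rintro _ ⟨_, ⟨z, hz, rfl⟩, rfl⟩
    have e : MvPolynomial.eval ![z, f z] (1 - (MvPolynomial.X 0 -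
      MvPolynomial.C (x 0)) * P - (MvPolynomial.X 1 - MvPolynomial.C (x 1)) * Q) =
      (z - x 0) * ((starRingEnd ℂ) (z - x 0) / N z - MvPolynomial.eval ![z, f z] P) +
      (f z - x 1) * ((starRingEnd ℂ) (f z - x 1) / N z - MvPolynomial.eval ![z, f z] Q) := by
      have h1 : (z - x 0) * ((starRingEnd ℂ) (z - x 0) / N z) +
          (f z - x 1) * ((starRingEnd ℂ) (f z - x 1) / N z) = 1 := by
        rw [mul_div_assoc', mul_div_assoc', ← add_div, div_eq_one_iff_eq (hN0 z hz)]
        simp only [hN]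
        ring
      simp only [map_sub, map_mul, map_one, MvPolynomial.eval_X, MvPolynomial.eval_C,
        Matrix.cons_val_zero, Matrix.cons_val_one] at h1 ⊢
      linear_combination -h1
    simp only [e]
    calc _ ≤ _ := norm_add_le _ _
      _ ≤ B0 * η + B1 * η := by
        rw [norm_mul, norm_mul]
        exact add_le_add
          (mul_le_mul (hB0 z hz) (hP z hz) (norm_nonneg _) hb0)
          (mul_le_mul (hB1 z hz) (hQ z hz) (norm_nonneg _) hb1)
      _ ≤ 1 / 2 := by
        rw [← add_mul, hη, mul_one_div, div_le_div_iff₀ (by positivity) (by norm_num)]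
        linarith
  have := hfin.trans hle
  simp at this
  norm_num at this

theorem stmt19 (f : ℂ → ℂ) (hf : ContinuousOn f (sphere (0:ℂ) 1)) :
    List.TFAE
      [ polyHull (graph1 f (sphere (0:ℂ) 1)) = graph1 f (sphere (0:ℂ) 1),
        NoAnalyticDisk (polyHull (graph1 f (sphere (0:ℂ) 1)) \ graph1 f (sphere (0:ℂ) 1)),
        ¬ ∃ g : ℂ → ℂ, ContinuousOn g (closedBall (0:ℂ) 1) ∧
            DifferentiableOn ℂ g (ball (0:ℂ) 1) ∧ ∀ z ∈ sphere (0:ℂ) 1, g z = f z,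
        genAlg {g : C(sphere (0:ℂ) 1, ℂ) |
            (∀ z : sphere (0:ℂ) 1, g z = (z : ℂ)) ∨
            (∀ z : sphere (0:ℂ) 1, g z = f (z : ℂ))} = Set.univ ] := by
  tfae_have 1 → 2 := by
    intro h φ _ hφ z hz
    have := hφ z hz
    rw [h] at this
    exact absurd this.1 this.2
  tfae_have 2 → 3 := aux_two_three f hf
  tfae_have 3 → 4 := by
    intro h
    set A := {g : C(sphere (0:ℂ) 1, ℂ) |
            (∀ z : sphere (0:ℂ) 1, g z = (z : ℂ)) ∨
            (∀ z : sphere (0:ℂ) 1, g z = f (z : ℂ))} with hA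
    have hs : A ⊆ (Algebra.adjoin ℂ A).topologicalClosure :=
      Algebra.subset_adjoin.trans (Subalgebra.le_topologicalClosure _)
    exact aux_wermer (Algebra.adjoin ℂ A).topologicalClosure
      (Subalgebra.isClosed_topologicalClosure _) (hs (Or.inl fun z => rfl)) f hf
      (hs (Or.inr fun z => rfl)) h
  tfae_have 4 → 1 := aux_four_one f hf
  tfae_finish
end
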